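/- arXiv:2506.21717 — 2 statements merged into one kernel-verified Lean document; each statement's English description precedes it below -/
import Mathlib

section
/- Let K be a field of characteristic different from 2, let φ be a nondegenerate quadratic form over K, and let ψ be a nondegenerate quadratic form over K of odd dimension. Then for every a ∈ K×, the form ⟨1,-a⟩ ⊗ (φ ⊗ ψ) is hyperbolic if and only if ⟨1,-a⟩ ⊗ φ is hyperbolic; in particular G(φ ⊗ ψ) = G(φ), where G(ρ) = {a ∈ K× : aρ ≅ ρ}. -/
open scoped TensorProduct

/-- A (finite-dimensional) quadratic form over the field `K`, bundled with its
underlying vector space. -/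
structure QF (K : Type) [Field K] where
  V : Type
  [iAG : AddCommGroup V]
  [iM : Module K V]
  [iFD : FiniteDimensional K V]
  q : QuadraticForm K V

namespace QF

variable {K : Type} [Field K]

instance (φ : QF K) : AddCommGroup φ.V := φ.iAG
instance (φ : QF K) : Module K φ.V := φ.iM
instance (φ : QF K) : FiniteDimensional K φ.V := φ.iFD

/-- dimension of a quadratic form -/
noncomputable def dim (φ : QF K) : ℕ := Module.finrank K φ.V

/-- isometry of quadratic forms -/
def Equiv (φ ψ : QF K) : Prop := QuadraticMap.Equivalent φ.q ψ.q

/-- nondegeneracy of a quadratic form (via its polar bilinear form) -/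
def Nondeg (φ : QF K) : Prop := (QuadraticMap.polarBilin φ.q).Nondegenerate

/-- scaling a quadratic form by a scalar -/
def smul (a : K) (φ : QF K) : QF K := { V := φ.V, q := a • φ.q }

/-- orthogonal sum of quadratic forms -/
def add (φ ψ : QF K) : QF K := { V := φ.V × ψ.V, q := φ.q.prod ψ.q }

/-- the zero-dimensional quadratic form -/
noncomputable def zero : QF K := { V := Fin 0 → K, q := QuadraticMap.weightedSumSquares K (fun i : Fin 0 => (1 : K)) }

/-- the form `⟨1⟩` -/
noncomputable def one : QF K := { V := Fin 1 → K, q := QuadraticMap.weightedSumSquares K (fun _ : Fin 1 => (1 : K)) }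

/-- the binary form `⟨1, -a⟩ = ⟪a⟫` -/
noncomputable def bin (a : K) : QF K :=
  { V := Fin 2 → K, q := QuadraticMap.weightedSumSquares K ![(1 : K), -a] }

/-- tensor product of quadratic forms -/
noncomputable def tmul [Invertible (2 : K)] (φ ψ : QF K) : QF K :=
  { V := φ.V ⊗[K] ψ.V, q := QuadraticForm.tmul φ.q ψ.q }

/-- `m` copies of the hyperbolic plane `⟨1, -1⟩` -/
noncomputable def hyperbolics : ℕ → QF K
  | 0 => zero
  | m + 1 => add (bin 1) (hyperbolics m)

/-- a form is hyperbolic if it is isometric to a sum of hyperbolic planes -/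
def IsHyperbolic (φ : QF K) : Prop := ∃ m : ℕ, φ.Equiv (hyperbolics m)

/-- anisotropy -/
def Anisotropic (φ : QF K) : Prop := φ.q.Anisotropic

/-- the Witt index -/
noncomputable def wittIndex (φ : QF K) : ℕ :=
  sSup {m : ℕ | ∃ ψ : QF K, φ.Equiv (add (hyperbolics m) ψ)}

/-- a form is split if its anisotropic part has dimension at most one -/
def IsSplit (φ : QF K) : Prop :=
  ∃ (m : ℕ) (ψ : QF K), ψ.Anisotropic ∧ ψ.dim ≤ 1 ∧ φ.Equiv (add (hyperbolics m) ψ)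

/-- `n`-fold orthogonal sum of a fixed form -/
noncomputable def nsmul : ℕ → QF K → QF K
  | 0, _ => zero
  | n + 1, φ => add φ (nsmul n φ)

/-- orthogonal sum of a list of forms -/
noncomputable def sumList : List (QF K) → QF K
  | [] => zero
  | φ :: l => add φ (sumList l)

/-- the Pfister form `⟨⟨a₁, …, aₙ⟩⟩` -/
noncomputable def pfister [Invertible (2 : K)] : List K → QF K
  | [] => one
  | a :: l => tmul (bin a) (pfister l)

/-- Witt equivalence of quadratic forms -/
def WittEquiv (φ ψ : QF K) : Prop := IsHyperbolic (add φ (smul (-1) ψ))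

/-- membership in the `n`-th power of the fundamental ideal: Witt equivalence
to an orthogonal sum of scaled `n`-fold Pfister forms -/
def InFundPow [Invertible (2 : K)] (n : ℕ) (φ : QF K) : Prop :=
  ∃ (r : ℕ) (c : Fin r → K) (l : Fin r → (Fin n → K)),
    (∀ i, c i ≠ 0) ∧
    WittEquiv φ (sumList ((List.finRange r).map fun i => smul (c i) (pfister (List.ofFn (l i)))))

/-- the group of similarity factors `G(φ) = {a ∈ K× : aφ ≅ φ}`, as a set -/
def G (φ : QF K) : Set K := {a | a ≠ 0 ∧ (smul a φ).Equiv φ}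

/-- similarity factors of a family of forms -/
def GT {r : ℕ} (φ : Fin r → QF K) : Set K := ⋂ i, G (φ i)

end QF

/-- a bundled field extension of `K` -/
structure FieldExt (K : Type) [Field K] where
  carrier : Type
  [iF : Field carrier]
  [iA : Algebra K carrier]

attribute [instance] FieldExt.iF FieldExt.iA

namespace QF

variable {K : Type} [Field K]

/-- base change of a quadratic form along a field extension -/
noncomputable def baseChange [Invertible (2 : K)] (L : Type) [Field L] [Algebra K L]
    (φ : QF K) : QF L :=
  { V := L ⊗[K] φ.V, q := QuadraticForm.baseChange L φ.q }

end QF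

/-- the set of nonzero norms of a finite field extension -/
def normSet (K : Type) [Field K] (L : Type) [Field L] [Algebra K L] : Set K :=
  {a | ∃ x : L, x ≠ 0 ∧ Algebra.norm K x = a}

/-- a finite `2`-extension: a tower of quadratic extensions -/
def IsTwoExtension (K : Type) [Field K] (L : Type) [Field L] [Algebra K L] : Prop :=
  FiniteDimensional K L ∧
    ∃ (n : ℕ) (F : Fin (n + 1) → IntermediateField K L),
      F 0 = ⊥ ∧ F (Fin.last n) = ⊤ ∧
        ∀ i : Fin n, F i.castSucc ≤ F i.succ ∧
          IntermediateField.relfinrank (F i.castSucc) (F i.succ) = 2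

/-- a multiquadratic extension: Galois with elementary abelian 2-group -/
def IsMultiquadratic (K : Type) [Field K] (L : Type) [Field L] [Algebra K L] : Prop :=
  FiniteDimensional K L ∧ IsGalois K L ∧ ∀ σ : L ≃ₐ[K] L, σ * σ = 1

namespace QF

variable {K : Type} [Field K] [Invertible (2 : K)]

/-- generating set for `Hyp(φ)`: norms from finite extensions splitting `φ` -/
def hypSet (φ : QF K) : Set K :=
  {a | ∃ L : FieldExt K, FiniteDimensional K L.carrier ∧
    IsHyperbolic (baseChange L.carrier φ) ∧ a ∈ normSet K L.carrier}

/-- the subgroup `Hyp(φ)` generated by norms of finite extensions splitting `φ` -/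
def Hyp (φ : QF K) : Submonoid K := Submonoid.closure (hypSet φ)

/-- generating set for `Hyp₂(φ)`: norms from finite 2-extensions splitting `φ` -/
def hypSet2 (φ : QF K) : Set K :=
  {a | ∃ L : FieldExt K, IsTwoExtension K L.carrier ∧
    IsHyperbolic (baseChange L.carrier φ) ∧ a ∈ normSet K L.carrier}

/-- the subgroup `Hyp₂(φ)` -/
def Hyp2 (φ : QF K) : Submonoid K := Submonoid.closure (hypSet2 φ)

/-- `H(φ) = K×² · Hyp(φ)` -/
def Hgrp (φ : QF K) : Set K :=
  {x | ∃ s : K, s ≠ 0 ∧ ∃ h ∈ Hyp φ, x = s ^ 2 * h}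

/-- `K×² · Hyp₂(φ)` -/
def H2grp (φ : QF K) : Set K :=
  {x | ∃ s : K, s ≠ 0 ∧ ∃ h ∈ Hyp2 φ, x = s ^ 2 * h}

/-- the splitting pattern: the set of Witt indices over all field extensions -/
def Sp (φ : QF K) : Set ℕ :=
  {m | ∃ L : FieldExt K, m = wittIndex (baseChange L.carrier φ)}

end QF

namespace QF

variable {K : Type} [Field K] [Invertible (2 : K)]

/-- norms from finite extensions splitting all forms in a family -/
def hypSetT {r : ℕ} (φ : Fin r → QF K) : Set K :=
  {a | ∃ L : FieldExt K, FiniteDimensional K L.carrier ∧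
    (∀ i, IsHyperbolic (baseChange L.carrier (φ i))) ∧ a ∈ normSet K L.carrier}

/-- the subgroup `Hyp` of a family of forms -/
def HypT {r : ℕ} (φ : Fin r → QF K) : Submonoid K := Submonoid.closure (hypSetT φ)

/-- norms from finite 2-extensions splitting all forms in a family -/
def hypSet2T {r : ℕ} (φ : Fin r → QF K) : Set K :=
  {a | ∃ L : FieldExt K, IsTwoExtension K L.carrier ∧
    (∀ i, IsHyperbolic (baseChange L.carrier (φ i))) ∧ a ∈ normSet K L.carrier}

/-- the subgroup `Hyp₂` of a family of forms -/
def Hyp2T {r : ℕ} (φ : Fin r → QF K) : Submonoid K := Submonoid.closure (hypSet2T φ)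

/-- `H` of a family of forms: `K×² · Hyp` -/
def HgrpT {r : ℕ} (φ : Fin r → QF K) : Set K :=
  {x | ∃ s : K, s ≠ 0 ∧ ∃ h ∈ HypT φ, x = s ^ 2 * h}

end QF

/-- the map `O → O'` between valuation rings induced by a compatible field embedding -/
def liftVSHom {K M : Type} [Field K] [Field M] [Algebra K M]
    (O : ValuationSubring K) (OM : ValuationSubring M)
    (hc : ∀ x : K, x ∈ O ↔ algebraMap K M x ∈ OM) : O →+* OM where
  toFun x := ⟨algebraMap K M x, (hc x).1 x.2⟩
  map_one' := by ext; simp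
  map_mul' x y := by ext; simp
  map_zero' := by ext; simp
  map_add' x y := by ext; simp

/-- `v` is unramified in the subextension `E` of `M/K`: the value group does not grow
and the residue field extension is separable (every residue is a simple root of a
separable polynomial over the residue field of `O`) -/
def UnramifiedIn {K M : Type} [Field K] [Field M] [Algebra K M]
    (O : ValuationSubring K) (OM : ValuationSubring M)
    (hc : ∀ x : K, x ∈ O ↔ algebraMap K M x ∈ OM) (E : IntermediateField K M) : Prop :=
  (∀ y : M, y ∈ E → y ≠ 0 →
      ∃ x : K, x ≠ 0 ∧ OM.valuation y = OM.valuation (algebraMap K M x)) ∧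
  (∀ y : M, y ∈ E → ∀ hy : y ∈ OM, ∃ p : Polynomial O, p.Monic ∧
      (p.map (IsLocalRing.residue O)).Separable ∧
      Polynomial.eval (⟨y, hy⟩ : OM) (p.map (liftVSHom O OM hc)) ∈ IsLocalRing.maximalIdeal OM)

/-- the value group of a valuation, as a subgroup of the units of the codomain -/
def unitsValueGroup {L Γ : Type} [Field L] [LinearOrderedCommGroupWithZero Γ]
    (w : Valuation L Γ) : Subgroup Γˣ :=
  (Units.map w.toMonoidWithZeroHom.toMonoidHom).range

/-- iterated Laurent series field, bundled with its field structure -/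
noncomputable def IterLaurentP (k : Type) [Field k] : ℕ → Σ' (T : Type), Field T :=
  fun n => Nat.rec ⟨k, ‹Field k›⟩
    (fun _ p => by letI := p.2; exact ⟨LaurentSeries p.1, inferInstance⟩) n

/-- iterated Laurent series field `k((t₁))…((tₙ))` -/
@[reducible] noncomputable def IterLaurent (k : Type) [Field k] (n : ℕ) : Type :=
  (IterLaurentP k n).1

noncomputable instance (k : Type) [Field k] (n : ℕ) : Field (IterLaurent k n) :=
  (IterLaurentP k n).2

/-- the embedding of the coefficient field in the iterated Laurent series field -/
noncomputable def iterC (k : Type) [Field k] : ∀ n, k →+* IterLaurent k n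
  | 0 => RingHom.id k
  | n + 1 => (HahnSeries.C : IterLaurent k n →+* LaurentSeries (IterLaurent k n)).comp (iterC k n)

/-- the variables `t₁, …, tₙ` of the iterated Laurent series field -/
noncomputable def tvar (k : Type) [Field k] : ∀ n, Fin n → IterLaurent k n
  | 0 => fun i => i.elim0
  | n + 1 => fun i =>
      (Fin.lastCases (motive := fun _ => LaurentSeries (IterLaurent k n))
        (HahnSeries.single 1 1) (fun j => HahnSeries.C (tvar k n j)) i : IterLaurent k (n + 1))

namespace WP
open Module QuadraticMap

section Basic
variable {K : Type} [Field K]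
variable {V W U : Type} [AddCommGroup V] [Module K V] 
  [AddCommGroup W] [Module K W] [AddCommGroup U] [Module K U]

/-- nondegeneracy, unbundled -/
def ND (Q : QuadraticForm K V) : Prop := ∀ x, (∀ y, polar Q x y = 0) → x = 0

/-- existence of a totally isotropic subspace of at least half dimension -/
def Neut (Q : QuadraticForm K V) : Prop :=
  ∃ L : Submodule K V, (∀ v ∈ L, Q v = 0) ∧ finrank K V ≤ 2 * finrank K L

theorem ND.nondegenerate {Q : QuadraticForm K V} (h : ND Q) : Q.polarBilin.Nondegenerate := by
  refine ⟨fun x hx => h x fun y => by simpa using hx y, fun x hx => h x fun y => ?_⟩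
  rw [polar_comm]; simpa using hx y

theorem ND.of_nondegenerate {Q : QuadraticForm K V} (h : Q.polarBilin.Nondegenerate) : ND Q := 
  fun x hx => h.1 x fun y => by simpa using hx y

theorem polar_of_eq {Q : QuadraticForm K V} {Q' : QuadraticForm K W} (f : V →ₗ[K] W) 
    (hf : ∀ x, Q' (f x) = Q x) (x y : V) : polar Q' (f x) (f y) = polar Q x y := by
  simp only [polar, ← map_add, hf]

theorem ND.equiv {Q : QuadraticForm K V} {Q' : QuadraticForm K W} (h : ND Q)
    (e : Q.Equivalent Q') : ND Q' := by
  obtain ⟨e⟩ := e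
  intro x hx
  have : e.symm x = 0 := h _ fun y => by
    have := polar_of_eq (Q := Q) (Q' := Q') e.toLinearEquiv.toLinearMap (fun x => e.map_app x) (e.symm x) y
    rw [← this]
    have h2 := hx (e y)
    rw [← e.apply_symm_apply x] at h2
    exact h2
  rw [← e.apply_symm_apply x, this]
  exact e.toLinearEquiv.map_zero

theorem Neut.equiv {Q : QuadraticForm K V} {Q' : QuadraticForm K W} (h : Neut Q)
    (e : Q.Equivalent Q') : Neut Q' := by
  obtain ⟨e⟩ := e
  obtain ⟨L, hL, hd⟩ := h
  refine ⟨L.map e.toLinearEquiv.toLinearMap, ?_, ?_⟩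
  · rintro _ ⟨x, hx, rfl⟩
    exact (e.map_app x).trans (hL x hx)
  · rw [← e.toLinearEquiv.finrank_eq]
    have := LinearEquiv.finrank_map_eq e.toLinearEquiv L
    exact hd.trans_eq (by rw [← this])

theorem Neut.congr {Q : QuadraticForm K V} {Q' : QuadraticForm K W} 
    (e : Q.Equivalent Q') : Neut Q ↔ Neut Q' := ⟨fun h => h.equiv e, fun h => h.equiv e.symm⟩

theorem ND.prod {Q : QuadraticForm K V} {Q' : QuadraticForm K W} (h : ND Q) (h' : ND Q') :
    ND (Q.prod Q') := by
  rintro ⟨x, y⟩ hxy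
  ext
  · exact h x fun z => by simpa using hxy (z, 0)
  · exact h' y fun z => by simpa using hxy (0, z)

theorem ND.of_prod_right {Q : QuadraticForm K V} {Q' : QuadraticForm K W} (h : ND (Q.prod Q')) :
    ND Q' := by
  intro y hy
  have := h (0, y) (by rintro ⟨a, b⟩; simp [hy])
  simpa using this

theorem isotropic_polar {Q : QuadraticForm K V} {L : Submodule K V} (hL : ∀ v ∈ L, Q v = 0)
    {x y : V} (hx : x ∈ L) (hy : y ∈ L) : polar Q x y = 0 := by
  simp [polar, hL _ hx, hL _ hy, hL _ (add_mem hx hy)]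

variable [FiniteDimensional K V] [FiniteDimensional K W]

theorem finrank_subprod (L : Submodule K V) (L' : Submodule K W) :
    finrank K (L.prod L') = finrank K L + finrank K L' := by
  rw [← finrank_prod]
  exact LinearEquiv.finrank_eq
    { toFun := fun x => (⟨x.1.1, x.2.1⟩, ⟨x.1.2, x.2.2⟩)
      invFun := fun x => ⟨(x.1.1, x.2.1), x.1.2, x.2.2⟩
      map_add' := fun _ _ => rfl
      map_smul' := fun _ _ => rfl
      left_inv := fun _ => rfl
      right_inv := fun _ => rfl }

theorem Neut.prod {Q : QuadraticForm K V} {Q' : QuadraticForm K W} (h : Neut Q) (h' : Neut Q') :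
    Neut (Q.prod Q') := by
  obtain ⟨L, hL, hd⟩ := h
  obtain ⟨L', hL', hd'⟩ := h'
  refine ⟨L.prod L', ?_, ?_⟩
  · rintro ⟨x, y⟩ ⟨hx, hy⟩
    simp [hL x hx, hL' y hy]
  · rw [finrank_prod, finrank_subprod]
    omega

/-- cancellation of neutral forms -/
theorem Neut.cancel {Q : QuadraticForm K V} {Q' : QuadraticForm K W} (hQ : ND Q) (hQ' : ND Q')
    (h : Neut (Q.prod Q')) (h' : Neut Q') : Neut Q := by
  obtain ⟨L, hL, hd⟩ := h
  obtain ⟨L', hL', hd'⟩ := h'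
  let A : Submodule K (V × W) := Submodule.prod ⊤ L'
  let C : Submodule K (V × W) := L ⊓ Submodule.prod ⊥ L'
  refine ⟨(L ⊓ A).map (LinearMap.fst K V W), ?_, ?_⟩
  · rintro _ ⟨⟨x, y⟩, ⟨h1, h2⟩, rfl⟩
    have := hL _ h1
    have h3 := hL' y h2.2
    simpa [h3] using this
  · have hA : finrank K A = finrank K V + finrank K L' := by
      rw [finrank_subprod, finrank_top]
    have hsup := Submodule.finrank_sup_add_finrank_inf_eq L A
    have hort := LinearMap.BilinForm.finrank_orthogonal (hQ.prod hQ').nondegenerate C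
    have hle : L ⊔ A ≤ LinearMap.BilinForm.orthogonal (Q.prod Q').polarBilin C := by
      refine sup_le ?_ ?_
      · intro x hx y hy
        exact isotropic_polar hL hy.1 hx
      · rintro ⟨x, y⟩ hx ⟨a, b⟩ hy
        have h1 : a = 0 := hy.2.1
        have h2 : b ∈ L' := hy.2.2
        have h3 : y ∈ L' := hx.2
        subst h1
        simpa using isotropic_polar hL' h2 h3
    have hle' := Submodule.finrank_mono hle
    have hker : finrank K ((LinearMap.fst K V W).domRestrict (L ⊓ A)).ker = finrank K C := by
      have : ((LinearMap.fst K V W).domRestrict (L ⊓ A)).ker.map (L ⊓ A).subtype = C := by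
        ext ⟨x, y⟩
        simp [A, C]
        tauto
      rw [← Submodule.finrank_map_subtype_eq (L ⊓ A), this]
    have hrn := ((LinearMap.fst K V W).domRestrict (L ⊓ A)).finrank_range_add_finrank_ker
    rw [LinearMap.range_domRestrict, hker] at hrn
    have hC := Submodule.finrank_le C
    rw [finrank_prod] at *
    omega
end Basic
end WP
namespace WP
open Module QuadraticMap

section Split
variable {K : Type} [Field K]
variable {V W U : Type} [AddCommGroup V] [Module K V] 
  [AddCommGroup W] [Module K W] [AddCommGroup U] [Module K U]

theorem Neut.neg {Q : QuadraticForm K V} (h : Neut Q) : Neut (-Q) := by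
  obtain ⟨L, hL, hd⟩ := h
  exact ⟨L, fun v hv => by simp [hL v hv], hd⟩

theorem ND.neg {Q : QuadraticForm K V} (h : ND Q) : ND (-Q) := by
  intro x hx
  refine h x fun y => ?_
  have := hx y
  simp only [polar, neg_apply] at this ⊢
  linear_combination -this

/-- the hyperbolic plane -/
noncomputable abbrev HP (K : Type) [Field K] : QuadraticForm K (Fin 2 → K) :=
  weightedSumSquares K ![(1 : K), -1]

theorem HP_apply (x : Fin 2 → K) : HP K x = x 0 * x 0 - x 1 * x 1 := by
  simp [weightedSumSquares_apply, Fin.sum_univ_two]; ring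

theorem Neut_HP : Neut (HP K) := by
  refine ⟨K ∙ (![1, 1] : Fin 2 → K), ?_, ?_⟩
  · intro v hv
    obtain ⟨c, rfl⟩ := Submodule.mem_span_singleton.1 hv
    simp
  · rw [finrank_span_singleton]
    · simp
    · intro h; simpa using congrFun h 0

theorem ND_HP [Invertible (2 : K)] : ND (HP K) := by
  have h2 : (2 : K) ≠ 0 := Invertible.ne_zero 2
  intro x hx
  have h0 := hx ![1, 0]
  have h1 := hx ![0, 1]
  simp only [polar, HP_apply] at h0 h1
  simp at h0 h1
  ext i
  fin_cases i
  · have : 2 * x 0 = 0 := by linear_combination h0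
    simpa [h2] using this
  · have : 2 * x 1 = 0 := by linear_combination -h1
    simpa [h2] using this

theorem exists_hyp_pair {Q : QuadraticForm K V} (hQ : ND Q) {e : V} (he : e ≠ 0) (h0 : Q e = 0) :
    ∃ f : V, Q f = 0 ∧ polar Q e f = 1 := by
  obtain ⟨y, hy⟩ : ∃ y, polar Q e y ≠ 0 := by
    by_contra! h
    exact he (hQ e h)
  set c := polar Q e y with hc
  have hee : polar Q e e = 0 := by simp [polar_self, h0]
  have h1 : polar Q e (c⁻¹ • y) = 1 := by simp [polar_smul_right, ← hc, hy]
  refine ⟨c⁻¹ • y + (-Q (c⁻¹ • y)) • e, ?_, ?_⟩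
  · rw [QuadraticMap.map_add Q, QuadraticMap.map_smul Q (-Q (c⁻¹ • y)) e, polar_smul_right, polar_comm, h1, h0]
    simp
  · rw [polar_add_right, h1, polar_smul_right, hee]; simp

theorem split [Invertible (2 : K)] [FiniteDimensional K V] {Q : QuadraticForm K V} (hQ : ND Q) {e : V}
    (he : e ≠ 0) (h0 : Q e = 0) :
    ∃ φ : QF K, ND φ.q ∧ Q.Equivalent ((HP K).prod φ.q) := by
  have h2 : (2 : K) ≠ 0 := Invertible.ne_zero 2
  obtain ⟨f, hf, hef⟩ := exists_hyp_pair hQ he h0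
  have hfe : polar Q f e = 1 := by rw [polar_comm, hef]
  have hee : polar Q e e = 0 := by simp [polar_self, h0]
  have hff : polar Q f f = 0 := by simp [polar_self, hf]
  let V' : Submodule K V := (Q.polarBilin e).ker ⊓ (Q.polarBilin f).ker
  have hV' (v : V') : polar Q e v = 0 ∧ polar Q f v = 0 := by
    obtain ⟨v, h1, h2⟩ := v
    exact ⟨by simpa using h1, by simpa using h2⟩
  let T : (Fin 2 → K) →ₗ[K] V := 
    (LinearMap.proj 0).smulRight (e + f) + (LinearMap.proj 1).smulRight (e - f)
  have hT (x) : T x = (x 0 + x 1) • e + (x 0 - x 1) • f := by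
    simp [T]; module
  have hQT (x) : Q (T x) = HP K x := by
    rw [hT, QuadraticMap.map_add Q, QuadraticMap.map_smul, QuadraticMap.map_smul, h0, hf, polar_smul_left, polar_smul_right, hef, HP_apply]
    simp only [smul_eq_mul]; ring
  let S : ((Fin 2 → K) × V') →ₗ[K] V := T.coprod V'.subtype
  have hS (x) : S x = (x.1 0 + x.1 1) • e + (x.1 0 - x.1 1) • f + x.2 := by
    simp [S, hT]
  have hinj : Function.Injective S := by
    rw [injective_iff_map_eq_zero]
    rintro ⟨x, v⟩ h
    rw [hS] at h
    obtain ⟨hv1, hv2⟩ := hV' v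
    have ha : polar Q e 0 = 0 := polar_zero_right _ _
    have hb : polar Q f 0 = 0 := polar_zero_right _ _
    rw [← h] at ha hb
    simp only [polar_add_right, polar_smul_right, hee, hef, hfe, hff, hv1, hv2, smul_eq_mul] at ha hb
    have hx0 : 2 * x 0 = 0 := by linear_combination ha + hb
    have hx1 : 2 * x 1 = 0 := by linear_combination hb - ha
    have hx0 : x 0 = 0 := by simpa [h2] using hx0
    have hx1 : x 1 = 0 := by simpa [h2] using hx1
    simp only [hx0, hx1] at h
    ext i
    · fin_cases i
      · exact hx0
      · exact hx1
    · simpa using h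
  have hsurj : Function.Surjective S := by
    intro v
    have hmem : v - polar Q f v • e - polar Q e v • f ∈ V' := by
      simp [V', polar_sub_right, polar_smul_right, hee, hef, hfe, hff]
    refine ⟨(![⅟2 * (polar Q f v + polar Q e v), ⅟2 * (polar Q f v - polar Q e v)], ⟨_, hmem⟩), ?_⟩
    rw [hS]
    have e1 : ⅟2 * (polar Q f v + polar Q e v) + ⅟2 * (polar Q f v - polar Q e v) = polar Q f v := by
      rw [invOf_eq_inv]; field_simp; ring
    have e2 : ⅟2 * (polar Q f v + polar Q e v) - ⅟2 * (polar Q f v - polar Q e v) = polar Q e v := by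
      rw [invOf_eq_inv]; field_simp; ring
    simp only [Matrix.cons_val_zero, Matrix.cons_val_one, e1, e2]
    abel
  let E := LinearEquiv.ofBijective S ⟨hinj, hsurj⟩
  have heq : ((HP K).prod (Q.comp V'.subtype)).Equivalent Q := by
    refine ⟨{ E with map_app' := ?_ }⟩
    rintro ⟨x, v⟩
    change Q (S (x, v)) = _
    have : S (x, v) = T x + v := by simp [S]
    rw [this, QuadraticMap.map_add Q, hQT, hT, polar_add_left, polar_smul_left, polar_smul_left, (hV' v).1, (hV' v).2]
    simp
  exact ⟨⟨V', Q.comp V'.subtype⟩, (hQ.equiv heq.symm).of_prod_right, heq.symm⟩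

theorem equiv_finrank {Q : QuadraticForm K V} {Q' : QuadraticForm K W} (e : Q.Equivalent Q') :
    finrank K V = finrank K W := by
  obtain ⟨e⟩ := e
  exact e.toLinearEquiv.finrank_eq

theorem hyperbolic_of_neut [Invertible (2 : K)] (n : ℕ) : ∀ φ : QF K, finrank K φ.V ≤ n → ND φ.q → Neut φ.q → 
    φ.IsHyperbolic := by
  induction n using Nat.strong_induction_on with
  | _ n ih =>
  intro φ hn hnd hneut
  by_cases h0 : finrank K φ.V = 0
  · refine ⟨0, ?_⟩
    have h1 : Subsingleton φ.V := finrank_zero_iff.1 h0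
    have h2 : finrank K φ.V = finrank K (Fin 0 → K) := by simp [h0]
    refine ⟨{ LinearEquiv.ofFinrankEq φ.V (Fin 0 → K) h2 with map_app' := ?_ }⟩
    intro m
    have : m = 0 := Subsingleton.elim _ _
    subst this
    simp only [map_zero]
    exact (weightedSumSquares_apply (fun _ : Fin 0 => (1 : K)) _).trans (by simp)
  · obtain ⟨L, hL, hd⟩ := id hneut
    have : L ≠ ⊥ := by
      rintro rfl
      rw [finrank_bot] at hd
      omega
    obtain ⟨e, heL, he⟩ := L.ne_bot_iff.1 this
    obtain ⟨φ', hnd', heq⟩ := split hnd he (hL e heL)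
    have h3 := equiv_finrank heq
    rw [finrank_prod, finrank_fin_fun] at h3
    have h4 : Neut φ'.q := by
      refine Neut.cancel hnd' ND_HP ?_ Neut_HP
      exact (hneut.equiv heq).equiv ⟨IsometryEquiv.prodComm _ _⟩
    obtain ⟨m, hm⟩ := ih (finrank K φ'.V) (by omega) φ' le_rfl hnd' h4
    refine ⟨m + 1, ?_⟩
    exact heq.trans (Equivalent.prod (Equivalent.refl _) hm)

theorem neut_hyperbolics [Invertible (2 : K)] : ∀ m, Neut (QF.hyperbolics (K := K) m).q
  | 0 => ⟨⊥, by simp, by change finrank K (Fin 0 → K) ≤ _; simp⟩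
  | m + 1 => by
    have h : Neut ((HP K).prod (QF.hyperbolics (K := K) m).q) := Neut.prod Neut_HP (neut_hyperbolics m)
    exact h

theorem hyperbolic_iff [Invertible (2 : K)] (φ : QF K) (h : ND φ.q) : φ.IsHyperbolic ↔ Neut φ.q := by
  constructor
  · rintro ⟨m, hm⟩
    exact (neut_hyperbolics m).equiv (QuadraticMap.Equivalent.symm hm)
  · exact hyperbolic_of_neut _ φ le_rfl h

theorem witt [Invertible (2 : K)] (n : ℕ) : ∀ φ φ' : QF K, finrank K φ.V ≤ n → 
    finrank K φ.V = finrank K φ'.V → ND φ.q → ND φ'.q → 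
    Neut (φ.q.prod (-φ'.q)) → φ.q.Equivalent φ'.q := by
  induction n using Nat.strong_induction_on with
  | _ n ih =>
  intro φ φ' hn hfr hnd hnd' hneut
  obtain ⟨L, hL, hd⟩ := id hneut
  rw [finrank_prod] at hd
  by_cases hA : ∀ v, (v, 0) ∈ L → v = 0
  · let g : L →ₗ[K] φ'.V := (LinearMap.snd K φ.V φ'.V).domRestrict L
    have hg : Function.Injective g := by
      rw [injective_iff_map_eq_zero]
      rintro ⟨⟨x, y⟩, hxy⟩ h
      have hy : y = 0 := h
      subst hy
      have := hA x hxy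
      subst this
      rfl
    have h1 := LinearMap.finrank_le_finrank_of_injective hg
    have h2 : finrank K L = finrank K φ'.V := by omega
    let G := LinearEquiv.ofInjectiveOfFinrankEq g hg h2
    let h : φ'.V →ₗ[K] φ.V := LinearMap.fst K φ.V φ'.V ∘ₗ L.subtype ∘ₗ G.symm.toLinearMap
    have hh (y) : φ.q (h y) = φ'.q y := by
      have h3 := hL _ (G.symm y).2
      have h4 : ((G.symm y : L) : φ.V × φ'.V).2 = y := G.apply_symm_apply y
      rw [QuadraticMap.prod_apply, h4] at h3
      simp only [_root_.neg_apply] at h3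
      change φ.q ((G.symm y : L) : φ.V × φ'.V).1 = _
      linear_combination h3
    have hinj : Function.Injective h := by
      rw [injective_iff_map_eq_zero]
      intro x hx
      refine hnd' x fun y => ?_
      rw [← polar_of_eq h hh, hx, polar_zero_left]
    exact QuadraticMap.Equivalent.symm ⟨{ LinearEquiv.ofInjectiveOfFinrankEq h hinj hfr.symm with map_app' := hh }⟩
  · push Not at hA
    obtain ⟨v, hvL, hv⟩ := hA
    have hv0 : φ.q v = 0 := by simpa using hL _ hvL
    obtain ⟨φ₁, hnd₁, heq₁⟩ := split hnd hv hv0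
    have h3 := equiv_finrank heq₁
    rw [finrank_prod, finrank_fin_fun] at h3
    have h4 : Neut (φ₁.q.prod (-φ'.q)) := by
      refine Neut.cancel (hnd₁.prod hnd'.neg) ND_HP ?_ Neut_HP
      refine (hneut.equiv (W := ((Fin 2 → K) × φ₁.V) × φ'.V) (Equivalent.prod heq₁ (Equivalent.refl (-φ'.q)))).equiv ?_
      refine ⟨{ toFun := fun x => ((x.1.2, x.2), x.1.1)
                invFun := fun x => ((x.2, x.1.1), x.1.2)
                map_add' := fun _ _ => rfl
                map_smul' := fun _ _ => rfl
                left_inv := fun _ => rfl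
                right_inv := fun _ => rfl
                map_app' := ?_ }⟩
      intro x
      simp only [QuadraticMap.prod_apply]
      ring
    obtain ⟨L₁, hL₁, hd₁⟩ := id h4
    rw [finrank_prod] at hd₁
    have h5 : ¬ Function.Injective ((LinearMap.fst K φ₁.V φ'.V).domRestrict L₁) := by
      intro h
      have := LinearMap.finrank_le_finrank_of_injective h
      omega
    rw [injective_iff_map_eq_zero] at h5
    push Not at h5
    obtain ⟨⟨⟨x, w⟩, hxw⟩, hx, hne⟩ := h5
    have hx : x = 0 := hx
    subst hx
    have hw : w ≠ 0 := by rintro rfl; exact hne rfl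
    have hw0 : φ'.q w = 0 := by simpa using hL₁ _ hxw
    obtain ⟨φ₂, hnd₂, heq₂⟩ := split hnd' hw hw0
    have h6 := equiv_finrank heq₂
    rw [finrank_prod, finrank_fin_fun] at h6
    have h7 : Neut (φ₁.q.prod (-φ₂.q)) := by
      refine Neut.cancel (hnd₁.prod hnd₂.neg) ND_HP.neg ?_ Neut_HP.neg
      obtain ⟨E⟩ := heq₂
      refine h4.equiv ?_
      have hE : (-φ'.q).Equivalent (-((HP K).prod φ₂.q)) := 
        ⟨{ E.toLinearEquiv with map_app' := fun m => congrArg Neg.neg (E.map_app m) }⟩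
      refine QuadraticMap.Equivalent.trans (Equivalent.prod (Equivalent.refl _) hE) ?_
      refine ⟨{ toFun := fun x => ((x.1, x.2.2), x.2.1)
                invFun := fun x => (x.1.1, (x.2, x.1.2))
                map_add' := fun _ _ => rfl
                map_smul' := fun _ _ => rfl
                left_inv := fun _ => rfl
                right_inv := fun _ => rfl
                map_app' := ?_ }⟩
      intro x
      simp only [QuadraticMap.prod_apply, _root_.neg_apply]
      ring
    have h8 := ih (finrank K φ₁.V) (by omega) φ₁ φ₂ le_rfl (by omega) hnd₁ hnd₂ h7
    exact heq₁.trans ((Equivalent.prod (Equivalent.refl _) h8).trans heq₂.symm)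
end Split
end WP
namespace WP
open Module QuadraticMap

/-- sign characters (orderings) of a field -/
structure IsSign {K : Type} [Field K] (χ : Kˣ → ℤ) : Prop where
  pm : ∀ a, χ a = 1 ∨ χ a = -1
  mul : ∀ a b, χ (a * b) = χ a * χ b
  neg_one : χ (-1) = -1
  add : ∀ a b c : Kˣ, (c : K) = a + b → χ a = 1 → χ b = 1 → χ c = 1

theorem odd_sum_pm {ι : Type} [Fintype ι] (f : ι → ℤ) (hf : ∀ i, f i = 1 ∨ f i = -1) 
    (hodd : Odd (Fintype.card ι)) : Odd (∑ i, f i) := by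
  have : ∑ i, (f i + 1) = ∑ i, f i + Fintype.card ι := by simp [Finset.sum_add_distrib]
  have h2 : Even (∑ i, (f i + 1)) := by
    apply Finset.even_sum
    intro i _
    rcases hf i with h | h <;> rw [h] <;> decide
  rw [this] at h2
  rw [← Nat.not_even_iff_odd, ← Int.even_coe_nat] at hodd
  rw [← Int.not_even_iff_odd]
  intro h3
  exact hodd ((Int.even_add.1 h2).1 h3)

theorem local_lemma {K : Type} [Field K] {A : Type} [CommRing A] [IsLocalRing A] (u : Kˣ →* A)
    (hsq : ∀ c, u c * u c = 1) (hneg : u (-1) = -1)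
    (hadd : ∀ a b c : Kˣ, (c : K) = a + b → u a + u b = u c * (1 + u (a * b)))
    {ι κ : Type} [Fintype ι] [Fintype κ] (a : ι → Kˣ) (c : κ → Kˣ) (hodd : Odd (Fintype.card κ))
    (hxy : (∑ i, u (a i)) * (∑ j, u (c j)) = 0)
    (hsig : ∀ χ : Kˣ → ℤ, IsSign χ → (∑ i, χ (a i)) * (∑ j, χ (c j)) = 0) :
    ∑ i, u (a i) = 0 := by
  classical
  by_cases h2 : IsUnit (2 : A)
  · have hpm (x : Kˣ) : u x = 1 ∨ u x = -1 := by
      have h1 : IsUnit ((1 + u x) + (1 - u x)) := by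
        have : (1 + u x) + (1 - u x) = 2 := by ring
        rwa [this]
      have h0 : (1 + u x) * (1 - u x) = 0 := by linear_combination -hsq x
      rcases IsLocalRing.isUnit_or_isUnit_of_isUnit_add h1 with h | h
      · left
        have := (h.mul_right_eq_zero).1 h0
        linear_combination -this
      · right
        have := (h.mul_left_eq_zero).1 h0
        linear_combination this
    have hne : (1 : A) ≠ -1 := by
      intro h
      have : (2 : A) = 0 := by linear_combination h
      rw [this] at h2
      exact not_isUnit_zero h2
    let χ : Kˣ → ℤ := fun x => if u x = 1 then 1 else -1
    have hχu (x) : u x = (χ x : A) := by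
      rcases hpm x with h | h
      · simp [χ, h]
      · simp [χ, h, hne.symm]
    have hχ1 (x) : χ x = 1 ↔ u x = 1 := by
      simp only [χ]
      split_ifs with h <;> simp [h]
    have hχ : IsSign χ := by
      refine ⟨fun x => ?_, fun x y => ?_, ?_, fun x y z hz hx hy => ?_⟩
      · simp only [χ]; split_ifs <;> simp
      · rcases hpm x with h | h <;> rcases hpm y with h' | h' <;> simp [χ, h, h', hne.symm]
      · simp [χ, hneg, hne.symm]
      · rw [hχ1] at *
        have := hadd x y z hz
        rw [map_mul, hx, hy] at this
        have h3 : (2 : A) * (u z - 1) = 0 := by linear_combination -this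
        have := (h2.mul_right_eq_zero).1 h3
        linear_combination this
    have h3 := hsig χ hχ
    have h4 := odd_sum_pm (fun j => χ (c j)) (fun j => hχ.pm _) hodd
    have h5 : ∑ j, χ (c j) ≠ 0 := by
      intro h; rw [h] at h4; exact absurd h4 (by decide)
    have h6 := (mul_eq_zero.1 h3).resolve_right h5
    simp only [hχu]
    rw [← Int.cast_sum, h6, Int.cast_zero]
  · have hm : (2 : A) ∈ IsLocalRing.maximalIdeal A := (IsLocalRing.mem_maximalIdeal _).2 h2
    have hres2 : (2 : IsLocalRing.ResidueField A) = 0 := by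
      rw [← map_ofNat (IsLocalRing.residue A) 2]
      exact (IsLocalRing.residue_eq_zero_iff _).2 hm
    have hu (x : Kˣ) : IsLocalRing.residue A (u x) = 1 := by
      have := congrArg (IsLocalRing.residue A) (hsq x)
      rw [map_mul, map_one] at this
      have h3 : (IsLocalRing.residue A (u x) - 1) ^ 2 = 0 := by
        linear_combination this + (1 - IsLocalRing.residue A (u x)) * hres2
      exact sub_eq_zero.1 (pow_eq_zero_iff (two_ne_zero)|>.1 h3)
    have hunit : IsUnit (∑ j, u (c j)) := by
      rw [← IsLocalRing.residue_ne_zero_iff_isUnit, map_sum]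
      simp only [hu]
      obtain ⟨k, hk⟩ := hodd
      simp [hk, hres2]
    exact (hunit.mul_left_eq_zero).1 hxy

theorem ring_lemma {K : Type} [Field K] {A : Type} [CommRing A] (u : Kˣ →* A)
    (hsq : ∀ c, u c * u c = 1) (hneg : u (-1) = -1)
    (hadd : ∀ a b c : Kˣ, (c : K) = a + b → u a + u b = u c * (1 + u (a * b)))
    {ι κ : Type} [Fintype ι] [Fintype κ] (a : ι → Kˣ) (c : κ → Kˣ) (hodd : Odd (Fintype.card κ))
    (hxy : (∑ i, u (a i)) * (∑ j, u (c j)) = 0)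
    (hsig : ∀ χ : Kˣ → ℤ, IsSign χ → (∑ i, χ (a i)) * (∑ j, χ (c j)) = 0) :
    ∑ i, u (a i) = 0 := by
  refine eq_zero_of_localization _ fun M hM => ?_
  let g := algebraMap A (Localization.AtPrime M)
  have := local_lemma (A := Localization.AtPrime M) (g.toMonoidHom.comp u) 
    (fun c => by simp [← map_mul, hsq]) (by simp [hneg])
    (fun a b c h => by
      have := congrArg g (hadd a b c h)
      simpa using this) a c hodd 
    (by
      have := congrArg g hxy
      simpa using this) hsig
  simpa using this
end WP

namespace WP
open Module QuadraticMap

section Diag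
variable {K : Type} [Field K]

theorem Neut.of_map {V U : Type} [AddCommGroup V] [Module K V] [AddCommGroup U] [Module K U]
    {Q : QuadraticForm K V} (f : U →ₗ[K] V) (hf : Function.Injective f)
    (h0 : ∀ u, Q (f u) = 0) (hd : finrank K V ≤ 2 * finrank K U) : Neut Q := by
  refine ⟨LinearMap.range f, ?_, ?_⟩
  · rintro _ ⟨u, rfl⟩; exact h0 u
  · rwa [LinearMap.finrank_range_of_inj hf]

/-- diagonal form with unit entries -/
noncomputable def D {ι : Type} [Fintype ι] (w : ι → Kˣ) : QuadraticForm K (ι → K) :=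
  weightedSumSquares K (fun i => (w i : K))

variable {ι κ : Type} [Fintype ι] [Fintype κ]

theorem D_apply (w : ι → Kˣ) (v : ι → K) : D w v = ∑ i, (w i : K) * (v i * v i) := by
  simp [D, weightedSumSquares_apply]

theorem D_reindex (w : ι → Kˣ) (w' : κ → Kˣ) (e : ι ≃ κ) (h : ∀ i, w' (e i) = w i) :
    (D w).Equivalent (D w') := by
  refine ⟨{ (LinearEquiv.funCongrLeft K K e).symm with map_app' := fun v => ?_ }⟩
  change D w' (fun j => v (e.symm j)) = D w v
  rw [D_apply, D_apply, ← Equiv.sum_comp e]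
  simp [h]

theorem D_sum (w : ι → Kˣ) (w' : κ → Kˣ) :
    (D (Sum.elim w w')).Equivalent ((D w).prod (D w')) := by
  refine ⟨{ LinearEquiv.sumArrowLequivProdArrow ι κ K K with map_app' := fun v => ?_ }⟩
  change D w (fun i => v (Sum.inl i)) + D w' (fun i => v (Sum.inr i)) = _
  simp [D_apply]

theorem Neut_D_smul {w : ι → Kˣ} (h : Neut (D w)) (c : Kˣ) : Neut (D fun i => c * w i) := by
  obtain ⟨L, hL, hd⟩ := h
  refine ⟨L, fun v hv => ?_, hd⟩
  have := hL v hv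
  rw [D_apply] at this ⊢
  simp only [Units.val_mul, mul_assoc]
  rw [← Finset.mul_sum]
  simp only [this, mul_zero]

theorem D_smul_neg (w : ι → Kˣ) (a : Kˣ) :
    (D (fun i => -a * w i)) = -((a : K) • D w) := by
  ext v
  simp [D_apply, Finset.mul_sum, mul_assoc]

section two
variable [Invertible (2 : K)]

theorem two_ne : (2 : K) ≠ 0 := Invertible.ne_zero 2

theorem assoc_D (w : ι → Kˣ) (x y : ι → K) :
    associated (R := K) (D w) x y = ∑ i, (w i : K) * (x i * y i) := by
  have h2 : (2 : K) ≠ 0 := two_ne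
  rw [associated_apply, D_apply, D_apply, D_apply, ← Finset.sum_sub_distrib, ← Finset.sum_sub_distrib,
    Module.End.smul_def, half_moduleEnd_apply_eq_half_smul, invOf_eq_inv]
  simp only [Pi.add_apply, smul_eq_mul]
  rw [Finset.mul_sum]
  refine Finset.sum_congr rfl fun i _ => ?_
  field_simp
  ring

theorem ND_D (w : ι → Kˣ) : ND (D w) := by
  classical
  intro x hx
  ext i
  have h := hx (Pi.single i 1)
  have h3 : associated (R := K) (D w) x (Pi.single i 1) = 0 := by
    rw [associated_apply]
    have : D w (x + Pi.single i 1) - D w x - D w (Pi.single i 1) = 0 := h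
    rw [this]; simp
  rw [assoc_D] at h3
  simpa [Pi.single_apply] using h3

theorem D_tmul (w : ι → Kˣ) (w' : κ → Kˣ) :
    (QuadraticForm.tmul (D w) (D w')).Equivalent (D fun p : ι × κ => w p.1 * w' p.2) := by
  classical
  let T := ((Pi.basisFun K ι).tensorProduct (Pi.basisFun K κ)).equivFun
  have hT : ∀ x y p, T (x ⊗ₜ[K] y) p = x p.1 * y p.2 := by
    rintro x y ⟨i, j⟩
    simp [T, mul_comm]
  have key : (D fun p : ι × κ => w p.1 * w' p.2).comp T.toLinearMap
      = QuadraticForm.tmul (D w) (D w') := by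
    have : associated (R := K) ((D fun p : ι × κ => w p.1 * w' p.2).comp T.toLinearMap)
        = associated (R := K) (QuadraticForm.tmul (D w) (D w')) := by
      rw [QuadraticForm.associated_tmul]
      refine TensorProduct.ext' fun x y => TensorProduct.ext' fun x' y' => ?_
      rw [associated_comp]
      simp only [LinearMap.compl₁₂_apply, LinearEquiv.coe_coe, assoc_D, hT]
      simp [assoc_D, Finset.sum_mul_sum, Fintype.sum_prod_type]
      rw [Finset.sum_comm]
      refine Finset.sum_congr rfl fun i _ => Finset.sum_congr rfl fun j _ => ?_
      ring
    exact (associated_rightInverse K (M := (ι → K) ⊗[K] (κ → K)) (N := K)).injective this 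
  refine ⟨{ T with map_app' := fun v => ?_ }⟩
  rw [← key]
  rfl

theorem tmul_congr {V V' W W' : Type} [AddCommGroup V] [Module K V] [AddCommGroup W] [Module K W]
    [AddCommGroup V'] [Module K V'] [AddCommGroup W'] [Module K W']
    {Q : QuadraticForm K V} {Q' : QuadraticForm K V'} {P : QuadraticForm K W}
    {P' : QuadraticForm K W'} (h : Q.Equivalent Q') (h' : P.Equivalent P') :
    (QuadraticForm.tmul Q P).Equivalent (QuadraticForm.tmul Q' P') := by
  obtain ⟨e⟩ := h
  obtain ⟨f⟩ := h'
  exact ⟨{ TensorProduct.congr e.toLinearEquiv f.toLinearEquiv with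
    map_app' := fun v => QuadraticForm.tmul_tensorMap_apply e.toIsometry f.toIsometry v }⟩

theorem diagonalize (φ : QF K) (h : ND φ.q) :
    ∃ w : Fin φ.dim → Kˣ, φ.q.Equivalent (D w) := by
  have h2 : (2 : K) ≠ 0 := two_ne
  obtain ⟨w, hw⟩ := QuadraticForm.equivalent_weightedSumSquares_units_of_nondegenerate' φ.q (by
    intro x hx
    refine h x fun y => ?_
    have := hx y
    rw [associated_apply] at this
    simpa [polar, h2] using this)
  refine ⟨w, hw.trans ?_⟩
  have : weightedSumSquares K w = D w := by
    ext v
    simp [D_apply, weightedSumSquares_apply, Units.smul_def]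
  rw [this]
  exact Equivalent.refl (D w)
end two

section sign
variable {χ : Kˣ → ℤ} 

theorem IsSign.one (h : IsSign χ) : χ 1 = 1 := by
  have := h.mul 1 1
  rcases h.pm 1 with h1 | h1 <;> rw [mul_one, h1] at this <;> omega

theorem IsSign.sq (h : IsSign χ) (a : Kˣ) : χ (a * a) = 1 := by
  rw [h.mul]; rcases h.pm a with h1 | h1 <;> simp [h1]

theorem IsSign.neg (h : IsSign χ) (a : Kˣ) : χ (-a) = - χ a := by
  rw [← neg_one_mul, h.mul, h.neg_one]; ring

theorem sum_pos (h : IsSign χ) (s : Finset ι) (x : ι → K)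
    (hx : ∀ i, x i = 0 ∨ ∃ u : Kˣ, (u : K) = x i ∧ χ u = 1) :
    (∀ i ∈ s, x i = 0) ∨ ∃ u : Kˣ, (u : K) = ∑ i ∈ s, x i ∧ χ u = 1 := by
  classical
  induction s using Finset.induction_on with
  | empty => left; simp
  | insert i s his ih =>
    rw [Finset.sum_insert his]
    rcases ih with ih | ⟨u, hu, hu1⟩
    · rcases hx i with h0 | ⟨v, hv, hv1⟩
      · left
        simpa [h0] using ih
      · right
        exact ⟨v, by rw [Finset.sum_eq_zero ih, add_zero, hv], hv1⟩
    · right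
      rcases hx i with h0 | ⟨v, hv, hv1⟩
      · exact ⟨u, by rw [h0, zero_add, hu], hu1⟩
      · rw [← hu, ← hv]
        have hne : (v : K) + u ≠ 0 := by
          intro h0
          have : v = -u := by
            ext; rw [Units.val_neg]; exact eq_neg_of_add_eq_zero_left h0
          rw [this, h.neg, hu1] at hv1
          omega
        exact ⟨Units.mk0 _ hne, rfl, h.add v u _ rfl hv1 hu1⟩

theorem sign_aux (h : IsSign χ) (w : ι → Kˣ) (v : ι → K) (hv : ∀ i, χ (w i) = -1 → v i = 0)
    (h0 : D w v = 0) : v = 0 := by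
  rw [D_apply] at h0
  have := sum_pos h Finset.univ (fun i => (w i : K) * (v i * v i)) (by
    intro i
    by_cases hi : v i = 0
    · left; simp [hi]
    · right
      refine ⟨w i * (Units.mk0 _ hi * Units.mk0 _ hi), by simp, ?_⟩
      rw [h.mul, h.sq, mul_one]
      rcases h.pm (w i) with h1 | h1
      · exact h1
      · exact absurd (hv i h1) hi)
  rcases this with h1 | ⟨u, hu, _⟩
  · ext i
    simpa using h1 i (Finset.mem_univ i)
  · rw [h0] at hu
    exact absurd hu u.ne_zero

theorem sign_aux2 (h : IsSign χ) (w : ι → Kˣ) (hw : Neut (D w)) :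
    Fintype.card ι ≤ 2 * Fintype.card {i // χ (w i) = -1} := by
  obtain ⟨L, hL, hd⟩ := hw
  let f : L →ₗ[K] ({i // χ (w i) = -1} → K) := (LinearMap.funLeft K K Subtype.val).comp L.subtype
  have hf : Function.Injective f := by
    rw [injective_iff_map_eq_zero]
    rintro ⟨v, hv⟩ h0
    have := sign_aux h w v (fun i hi => congrFun h0 ⟨i, hi⟩) (hL v hv)
    simpa using this
  have := LinearMap.finrank_le_finrank_of_injective hf
  rw [finrank_fintype_fun_eq_card] at this hd
  omega

theorem sign_sum (h : IsSign χ) (w : ι → Kˣ) (hw : Neut (D w)) : ∑ i, χ (w i) = 0 := by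
  classical
  have h1 := sign_aux2 h w hw
  have h2 := sign_aux2 h (fun i => -1 * w i) (Neut_D_smul hw (-1))
  simp only [neg_one_mul, h.neg, neg_inj] at h2
  rw [Fintype.card_subtype] at h1 h2
  have h3 : ∀ i, χ (w i) = (if χ (w i) = 1 then 1 else 0) - (if χ (w i) = -1 then 1 else 0) := by
    intro i; rcases h.pm (w i) with h | h <;> simp [h]
  have h4 : ∀ i, (1 : ℤ) = (if χ (w i) = 1 then 1 else 0) + (if χ (w i) = -1 then 1 else 0) := by
    intro i; rcases h.pm (w i) with h | h <;> simp [h]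
  have h5 : (Fintype.card ι : ℤ) = ∑ i : ι, 1 := by simp
  rw [Finset.sum_congr rfl fun i _ => h4 i, Finset.sum_add_distrib, Finset.sum_boole,
    Finset.sum_boole] at h5
  rw [Finset.sum_congr rfl fun i _ => h3 i, Finset.sum_sub_distrib, Finset.sum_boole,
    Finset.sum_boole]
  omega
end sign

section relations

theorem Neut_pair (c : Kˣ) : Neut (D ![c * c, -1]) := by
  refine Neut.of_map (U := K) 
    { toFun := fun x => ![x, c * x]
      map_add' := fun x y => by ext i; fin_cases i <;> simp [mul_add]
      map_smul' := fun x y => by ext i; fin_cases i <;> simp [mul_left_comm] } ?_ ?_ ?_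
  · intro x y hxy
    simpa using congrFun hxy 0
  · intro x
    simp [D_apply, Fin.sum_univ_two]; ring
  · simp

theorem Neut_four (a b c : Kˣ) (h : (c : K) = a + b) : Neut (D ![a, b, -c, -(c * (a * b))]) := by
  refine Neut.of_map (U := K × K) 
    { toFun := fun x => ![x.1 + b * x.2, x.1 - a * x.2, x.1, x.2]
      map_add' := fun x y => by ext i; fin_cases i <;> simp <;> ring
      map_smul' := fun x y => by ext i; fin_cases i <;> simp <;> ring } ?_ ?_ ?_
  · intro x y hxy
    have h1 := congrFun hxy 2
    have h2 := congrFun hxy 3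
    ext
    · simpa using h1
    · simpa using h2
  · intro x
    simp [D_apply, Fin.sum_univ_four, h]; ring
  · simp

end relations

section ring

/-- formal sum of diagonal entries -/
noncomputable def F (w : ι → Kˣ) : MonoidAlgebra ℤ Kˣ := ∑ i, MonoidAlgebra.of ℤ Kˣ (w i)

theorem F_inj (w : ι → Kˣ) (w' : κ → Kˣ) (h : F w = F w') : (D w).Equivalent (D w') := by
  classical
  have hc : ∀ g, Fintype.card {i // w i = g} = Fintype.card {j // w' j = g} := by
    intro g
    have := congrArg (fun x => x.coeff g) h
    simpa [F, MonoidAlgebra.of_apply, Finset.sum_boole, Fintype.card_subtype, Finsupp.single_apply, Finsupp.finsetSum_apply] using this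
  let e : ι ≃ κ := (Equiv.sigmaFiberEquiv w).symm.trans
    ((Equiv.sigmaCongrRight fun g => Fintype.equivOfCardEq (hc g)).trans (Equiv.sigmaFiberEquiv w'))
  refine D_reindex w w' e fun i => ?_
  exact (Fintype.equivOfCardEq (hc (w i)) ⟨i, rfl⟩).2

theorem F_sum (w : ι → Kˣ) (w' : κ → Kˣ) : F (Sum.elim w w') = F w + F w' := by
  simp [F]

theorem F_smul (w : ι → Kˣ) (c : Kˣ) : F (fun i => c * w i) = MonoidAlgebra.of ℤ Kˣ c * F w := by
  simp only [F, Finset.mul_sum, map_mul]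

theorem Neut_sum {w : ι → Kˣ} {w' : κ → Kˣ} (h : Neut (D w)) (h' : Neut (D w')) :
    Neut (D (Sum.elim w w')) := (h.prod h').equiv (D_sum w w').symm

theorem Neut_empty : Neut (D (fun i : Empty => (i.elim : Kˣ))) :=
  ⟨⊥, fun v hv => by simp [D_apply], by simp⟩

/-- the additive group of Witt-trivial elements -/
noncomputable def J₀ (K : Type) [Field K] : AddSubgroup (MonoidAlgebra ℤ Kˣ) where
  carrier := {x | ∃ (ι κ : Type) (_ : Fintype ι) (_ : Fintype κ) (w : ι → Kˣ) (w' : κ → Kˣ),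
    Neut (D w) ∧ Neut (D w') ∧ x = F w - F w'}
  zero_mem' := ⟨Empty, Empty, inferInstance, inferInstance, _, _, Neut_empty, Neut_empty, by simp⟩
  add_mem' := by
    rintro _ _ ⟨ι, κ, _, _, w, w', h, h', rfl⟩ ⟨ι₂, κ₂, _, _, w₂, w₂', h₂, h₂', rfl⟩
    refine ⟨ι ⊕ ι₂, κ ⊕ κ₂, inferInstance, inferInstance, _, _, Neut_sum h h₂, Neut_sum h' h₂', ?_⟩
    rw [F_sum, F_sum]; abel
  neg_mem' := by
    rintro _ ⟨ι, κ, _, _, w, w', h, h', rfl⟩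
    exact ⟨κ, ι, _, _, w', w, h', h, by simp⟩

/-- the ideal of Witt-trivial elements -/
noncomputable def J (K : Type) [Field K] : Ideal (MonoidAlgebra ℤ Kˣ) where
  __ := J₀ K
  smul_mem' := by
    intro c x hx
    change c * x ∈ J₀ K
    change x ∈ J₀ K at hx
    induction c using MonoidAlgebra.induction_on with
    | of g =>
      obtain ⟨ι, κ, _, _, w, w', h, h', rfl⟩ := hx
      exact ⟨ι, κ, _, _, _, _, Neut_D_smul h g, Neut_D_smul h' g, by rw [F_smul, F_smul, mul_sub]⟩
    | add a b ha hb => rw [add_mul]; exact add_mem ha hb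
    | smul r a ha => rw [smul_mul_assoc]; exact zsmul_mem ha r

variable [Invertible (2 : K)]

theorem mem_J (w : ι → Kˣ) : F w ∈ J K ↔ Neut (D w) := by
  constructor
  · intro h
    obtain ⟨ι', κ', _, _, w₁, w₂, h₁, h₂, he⟩ := h
    have : F (Sum.elim w w₂) = F w₁ := by rw [F_sum, he]; abel
    have h3 := h₁.equiv (F_inj _ _ this).symm
    exact Neut.cancel (ND_D _) (ND_D _) (h3.equiv (D_sum _ _)) h₂
  · intro h
    exact ⟨ι, Empty, _, _, w, _, h, Neut_empty, by simp [F]⟩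

theorem F_mul (a : ι → Kˣ) (c : κ → Kˣ) :
    F (fun p : ι × κ => a p.1 * c p.2) = F a * F c := by
  simp only [F, map_mul, Finset.sum_mul_sum, Fintype.sum_prod_type]

theorem main_aux {A : Type} [CommRing A] (π : MonoidAlgebra ℤ Kˣ →+* A)
    (hπ : ∀ x, π x = 0 ↔ x ∈ J K) (a : ι → Kˣ) (c : κ → Kˣ) (hodd : Odd (Fintype.card κ))
    (h : Neut (D fun p : ι × κ => a p.1 * c p.2)) : Neut (D a) := by
  let u : Kˣ →* A := (π : MonoidAlgebra ℤ Kˣ →* A).comp (MonoidAlgebra.of ℤ Kˣ)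
  have hF : ∀ {τ : Type} [Fintype τ] (w : τ → Kˣ), ∑ i, u (w i) = π (F w) := by
    intro τ _ w; simp [u, F]
  have hz : ∀ {τ : Type} [Fintype τ] (w : τ → Kˣ), Neut (D w) → ∑ i, u (w i) = 0 := by
    intro τ _ w hw
    rw [hF, hπ, mem_J]; exact hw
  have hneg : u (-1) = -1 := by
    have := hz _ (Neut_pair (1 : Kˣ))
    simp only [Fin.sum_univ_two, Matrix.cons_val_zero, Matrix.cons_val_one, mul_one, map_one] at this
    exact eq_neg_of_add_eq_zero_right this
  have hneg' : ∀ x, u (-x) = - u x := by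
    intro x; rw [← neg_one_mul, map_mul, hneg, neg_one_mul]
  have hsq : ∀ x, u x * u x = 1 := by
    intro x
    have := hz _ (Neut_pair x)
    simp only [Fin.sum_univ_two, Matrix.cons_val_zero, Matrix.cons_val_one, hneg, map_mul] at this
    exact add_neg_eq_zero.mp this
  have hadd : ∀ a b c : Kˣ, (c : K) = a + b → u a + u b = u c * (1 + u (a * b)) := by
    intro x y z hxyz
    have := hz _ (Neut_four x y z hxyz)
    simp only [Fin.sum_univ_four, Matrix.cons_val, hneg', map_mul] at this
    rw [map_mul]
    linear_combination this
  have := ring_lemma u hsq hneg hadd a c hodd (by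
    rw [hF, hF, ← map_mul, ← F_mul, hπ, mem_J]; exact h) (by
    intro χ hχ
    rw [← sign_sum hχ _ h, Fintype.sum_prod_type, Finset.sum_mul_sum]
    simp only [hχ.mul])
  rwa [hF, hπ, mem_J] at this

theorem exists_quot {R : Type} [CommRing R] (I : Ideal R) :
    ∃ (A : Type) (_ : CommRing A) (π : R →+* A), ∀ x, π x = 0 ↔ x ∈ I :=
  ⟨R ⧸ I, inferInstance, Ideal.Quotient.mk I, fun _ => Ideal.Quotient.eq_zero_iff_mem⟩

theorem main (a : ι → Kˣ) (c : κ → Kˣ) (hodd : Odd (Fintype.card κ)) :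
    Neut (D fun p : ι × κ => a p.1 * c p.2) ↔ Neut (D a) := by
  constructor
  · obtain ⟨A, _, π, hπ⟩ := exists_quot (J K)
    exact main_aux π hπ a c hodd
  · intro h
    rw [← mem_J] at h ⊢
    rw [F_mul]
    exact Ideal.mul_mem_right _ _ h

end ring
end Diag
end WP

namespace WP
open Module QuadraticMap

section Final
variable {K : Type} [Field K] [Invertible (2 : K)]

theorem bin_eq (a : Kˣ) : (QF.bin (a : K)).q = D ![1, -a] := by
  change weightedSumSquares K ![(1 : K), -(a : K)] = _
  ext v
  rw [D_apply, weightedSumSquares_apply]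
  simp [Fin.sum_univ_two]

theorem bin_tmul {ι : Type} [Fintype ι] (a : Kˣ) (φ : QF K) (w : ι → Kˣ)
    (h : φ.q.Equivalent (D w)) :
    (QF.tmul (QF.bin (a : K)) φ).q.Equivalent
      (D fun p : Fin 2 × ι => (![1, -a] : Fin 2 → Kˣ) p.1 * w p.2) := by
  refine Equivalent.trans (tmul_congr (Q' := D ![1, -a]) ?_ h) (D_tmul _ _)
  exact bin_eq a ▸ Equivalent.refl _

theorem hyp_bin {ι : Type} [Fintype ι] (a : Kˣ) (φ : QF K) (w : ι → Kˣ)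
    (h : φ.q.Equivalent (D w)) :
    (QF.tmul (QF.bin (a : K)) φ).IsHyperbolic ↔
      Neut (D fun p : Fin 2 × ι => (![1, -a] : Fin 2 → Kˣ) p.1 * w p.2) := by
  have e := bin_tmul a φ w h
  rw [hyperbolic_iff _ ((ND_D _).equiv e.symm)]
  exact Neut.congr e

theorem D_two {ι : Type} [Fintype ι] (a : Kˣ) (w : ι → Kˣ) :
    (D fun p : Fin 2 × ι => (![1, -a] : Fin 2 → Kˣ) p.1 * w p.2).Equivalent
      ((D w).prod (-((a : K) • D w))) := by
  rw [← D_smul_neg]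
  refine Equivalent.trans ?_ (D_sum _ _)
  refine D_reindex _ _ (((Equiv.prodCongrLeft fun _ => finTwoEquiv).trans
    (Equiv.boolProdEquivSum ι))) ?_
  rintro ⟨i, j⟩
  fin_cases i <;> simp [finTwoEquiv, Equiv.prodCongrLeft, Equiv.boolProdEquivSum]

theorem smul_equiv {V W : Type} [AddCommGroup V] [Module K V] [AddCommGroup W] [Module K W]
    {Q : QuadraticForm K V} {Q' : QuadraticForm K W} (a : K) (h : Q.Equivalent Q') :
    (a • Q).Equivalent (a • Q') := by
  obtain ⟨e⟩ := h
  exact ⟨{ e.toLinearEquiv with map_app' := fun m => congrArg (a • ·) (e.map_app m) }⟩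

theorem neg_equiv {V W : Type} [AddCommGroup V] [Module K V] [AddCommGroup W] [Module K W]
    {Q : QuadraticForm K V} {Q' : QuadraticForm K W} (h : Q.Equivalent Q') :
    (-Q).Equivalent (-Q') := by
  obtain ⟨e⟩ := h
  exact ⟨{ e.toLinearEquiv with map_app' := fun m => congrArg Neg.neg (e.map_app m) }⟩

theorem Neut_diag {V : Type} [AddCommGroup V] [Module K V] [FiniteDimensional K V]
    (Q : QuadraticForm K V) : Neut (Q.prod (-Q)) := by
  refine Neut.of_map (LinearMap.prod LinearMap.id LinearMap.id) ?_ ?_ ?_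
  · intro x y h; exact congrArg Prod.fst h
  · intro x; simp
  · rw [finrank_prod]; omega

theorem mem_G {ι : Type} [Fintype ι] (a : Kˣ) (φ : QF K) (w : ι → Kˣ)
    (h : φ.q.Equivalent (D w)) :
    (a : K) ∈ φ.G ↔ (QF.tmul (QF.bin (a : K)) φ).IsHyperbolic := by
  rw [hyp_bin a φ w h, Neut.congr (D_two a w)]
  have e : (φ.q.prod (-((a : K) • φ.q))).Equivalent ((D w).prod (-((a : K) • D w))) :=
    Equivalent.prod h (neg_equiv (smul_equiv _ h))
  rw [← Neut.congr e]
  have hnd : ND φ.q := (ND_D w).equiv h.symm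
  constructor
  · rintro ⟨_, h1⟩
    have h1 : ((a : K) • φ.q).Equivalent φ.q := h1
    exact (Neut_diag φ.q).equiv (Equivalent.prod (Equivalent.refl _) (neg_equiv h1.symm))
  · intro h1
    refine ⟨a.ne_zero, ?_⟩
    refine Equivalent.symm (witt _ φ (QF.smul a φ) le_rfl rfl hnd ?_ h1)
    intro x hx
    refine hnd x fun y => ?_
    have := hx y
    have h3 : (a : K) * polar φ.q x y = 0 := by
      rw [← this]
      exact (polar_smul _ (a : K) x y).symm
    simpa using h3

theorem final (φ ψ : QF K) (hφ : ND φ.q) (hψ : ND ψ.q) (hodd : Odd ψ.dim) :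
    (∀ a : K, a ≠ 0 →
      (QF.IsHyperbolic (QF.tmul (QF.bin a) (QF.tmul φ ψ)) ↔
        QF.IsHyperbolic (QF.tmul (QF.bin a) φ))) ∧
    QF.G (QF.tmul φ ψ) = QF.G φ := by
  obtain ⟨w, hw⟩ := diagonalize φ hφ
  obtain ⟨c, hc⟩ := diagonalize ψ hψ
  have hwc : (QF.tmul φ ψ).q.Equivalent (D fun p : Fin φ.dim × Fin ψ.dim => w p.1 * c p.2) :=
    Equivalent.trans (tmul_congr hw hc) (D_tmul _ _)
  have key : ∀ a : Kˣ, (QF.IsHyperbolic (QF.tmul (QF.bin (a : K)) (QF.tmul φ ψ)) ↔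
        QF.IsHyperbolic (QF.tmul (QF.bin (a : K)) φ)) := by
    intro a
    rw [hyp_bin a _ _ hwc, hyp_bin a _ _ hw, ← main (fun p : Fin 2 × Fin φ.dim => (![1, -a] : Fin 2 → Kˣ) p.1 * w p.2) c (by simpa using hodd)]
    refine Neut.congr (D_reindex _ _ (Equiv.prodAssoc _ _ _).symm ?_)
    rintro ⟨i, j, k⟩
    simp [mul_assoc]
  refine ⟨fun a ha => key (Units.mk0 a ha), ?_⟩
  ext a
  by_cases ha : a = 0
  · simp [QF.G, ha]
  · have h1 := mem_G (Units.mk0 a ha) _ _ hwc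
    have h2 := mem_G (Units.mk0 a ha) _ _ hw
    exact h1.trans ((key (Units.mk0 a ha)).trans h2.symm)
end Final
end WP

/-- tensoring with an odd-dimensional form preserves and reflects
hyperbolicity of `⟨1,-a⟩ ⊗ ·`, and `G(φ ⊗ ψ) = G(φ)`. -/
theorem stmt0 (K : Type) [Field K] [Invertible (2 : K)]
    (φ ψ : QF K) (hφ : φ.Nondeg) (hψ : ψ.Nondeg) (hodd : Odd ψ.dim) :
    (∀ a : K, a ≠ 0 →
      (QF.IsHyperbolic (QF.tmul (QF.bin a) (QF.tmul φ ψ)) ↔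
        QF.IsHyperbolic (QF.tmul (QF.bin a) φ))) ∧
    QF.G (QF.tmul φ ψ) = QF.G φ := by
  exact WP.final φ ψ (WP.ND.of_nondegenerate hφ) (WP.ND.of_nondegenerate hψ) hodd
end

section
/- Let K be a field of characteristic different from 2 and φ a nondegenerate quadratic form over K with a ∈ G(φ). Then either φ is split (its anisotropic part has dimension at most 1), or there exists a quadratic field extension L/K such that the Witt index of φ_L is strictly greater than the Witt index of φ and a is a norm from L, i.e. a ∈ N_{L/K}(L×). -/
open scoped TensorProduct

namespace QFaux
open QuadraticMap

section plane
variable {F M : Type} [Field F] [AddCommGroup M] [Module F M]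

def perp (Q : QuadraticForm F M) (v u : M) : Submodule F M :=
  LinearMap.ker (polarBilin Q v) ⊓ LinearMap.ker (polarBilin Q u)

lemma mem_perp {Q : QuadraticForm F M} {v u z : M} :
    z ∈ perp Q v u ↔ polar Q v z = 0 ∧ polar Q u z = 0 := by
  simp [perp]

lemma q_add (Q : QuadraticForm F M) (x y : M) : Q (x + y) = Q x + Q y + polar Q x y := by
  simp [polar]

lemma polar_self' (Q : QuadraticForm F M) (x : M) : polar Q x x = 2 * Q x := by
  have := QuadraticMap.polar_self Q x
  rw [this]; simp

/-- projection to the perp of a hyperbolic pair -/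
def toPerp (Q : QuadraticForm F M) (v u : M) (hv : Q v = 0) (hu : Q u = 0)
    (hvu : polar Q v u = 1) : M →ₗ[F] perp Q v u :=
  LinearMap.codRestrict _ (LinearMap.id - (polarBilin Q u).smulRight v
    - (polarBilin Q v).smulRight u) (by
    intro z
    rw [mem_perp]
    have huv : polar Q u v = 1 := by rw [polar_comm, hvu]
    constructor <;>
    simp [polar_sub_right, polar_smul_right, polar_self', hv, hu, hvu, huv])

lemma split_plane [Invertible (2 : F)] (Q : QuadraticForm F M) (v u : M) (hv : Q v = 0)
    (hu : Q u = 0) (hvu : polar Q v u = 1) :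
    Q.Equivalent ((weightedSumSquares F ![(1 : F), -1]).prod (Q.comp (perp Q v u).subtype)) := by
  have h2 : (2 : F) * ⅟2 = 1 := mul_invOf_self _
  have huv : polar Q u v = 1 := by rw [polar_comm, hvu]
  let g : ((Fin 2 → F) × perp Q v u) →ₗ[F] M :=
    LinearMap.coprod
      ((LinearMap.proj (R := F) (φ := fun _ : Fin 2 => F) 0
          - LinearMap.proj (R := F) (φ := fun _ : Fin 2 => F) 1).smulRight v
        + (LinearMap.proj (R := F) (φ := fun _ : Fin 2 => F) 0
          + LinearMap.proj (R := F) (φ := fun _ : Fin 2 => F) 1).smulRight u)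
      (perp Q v u).subtype
  have hg : ∀ x w, g (x, w) = (x 0 - x 1) • v + (x 0 + x 1) • u + (w : M) := by
    intro x w; simp [g]
  have hiso : ∀ p, Q (g p) = ((weightedSumSquares F ![(1 : F), -1]).prod
      (Q.comp (perp Q v u).subtype)) p := by
    rintro ⟨x, w, hw⟩
    rw [mem_perp] at hw
    rw [hg]
    simp only [q_add, polar_add_left, polar_smul_left, polar_smul_right, QuadraticMap.map_smul,
      hv, hu, hvu, hw.1, hw.2]
    simp [weightedSumSquares_apply, Fin.sum_univ_two]
    ring
  have hb : Function.Bijective g := by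
    constructor
    · rw [← LinearMap.ker_eq_bot, LinearMap.ker_eq_bot']
      rintro ⟨x, w, hw⟩ h
      rw [hg] at h
      rw [mem_perp] at hw
      have h1 : polar Q v ((x 0 - x 1) • v + (x 0 + x 1) • u + w) = 0 := by
        simp only at h; rw [h]; simp
      have h3 : polar Q u ((x 0 - x 1) • v + (x 0 + x 1) • u + w) = 0 := by
        simp only at h; rw [h]; simp
      simp [polar_add_right, polar_smul_right, polar_self', hv, hu, hvu, huv, hw] at h1 h3
      have e0 : x 0 = 0 := by linear_combination (⅟2) * (h1 + h3) - x 0 * h2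
      have e1 : x 1 = 0 := by linear_combination h1 - e0
      have e2 : w = 0 := by simpa [e0, e1] using h
      ext i
      · fin_cases i <;> simp [e0, e1]
      · simp [e2]
    · intro z
      refine ⟨(![⅟2 * (polar Q v z + polar Q u z), ⅟2 * (polar Q v z - polar Q u z)],
        toPerp Q v u hv hu hvu z), ?_⟩
      rw [hg]
      have a1 : ⅟2 * (polar Q v z + polar Q u z) - ⅟2 * (polar Q v z - polar Q u z)
        = polar Q u z := by linear_combination polar Q u z * h2
      have a2 : ⅟2 * (polar Q v z + polar Q u z) + ⅟2 * (polar Q v z - polar Q u z)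
        = polar Q v z := by linear_combination polar Q v z * h2
      simp only [Matrix.cons_val_zero, Matrix.cons_val_one]
      rw [a1, a2]
      simp [toPerp]
  let e := LinearEquiv.ofBijective g hb
  exact ⟨(⟨e, fun p => hiso p⟩ : QuadraticMap.IsometryEquiv _ _).symm⟩

/-- an isotropic vector that is not in the radical yields a hyperbolic pair -/
lemma exists_pair (Q : QuadraticForm F M) (v w : M) (hv : Q v = 0) (h : polar Q v w ≠ 0) :
    ∃ s t : F, Q (s • v + t • w) = 0 ∧ polar Q v (s • v + t • w) = 1 := by
  refine ⟨- Q w * (polar Q v w)⁻¹ * (polar Q v w)⁻¹, (polar Q v w)⁻¹, ?_, ?_⟩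
  · simp only [q_add, polar_smul_left, polar_smul_right, QuadraticMap.map_smul, hv, smul_eq_mul]
    field_simp
    ring
  · simp only [polar_add_right, polar_smul_right, polar_self', hv, smul_eq_mul]
    field_simp
    ring
end plane

/-- totally isotropic subspaces are bounded -/
lemma ti_bound {F M : Type} [Field F] [AddCommGroup M] [Module F M] [FiniteDimensional F M]
    (B : M →ₗ[F] M →ₗ[F] F) (T Y : Submodule F M)
    (hY : ∀ x ∈ Y, ∀ y ∈ Y, B x y = 0)
    (hT : ∀ y ∈ Y, (∀ t ∈ T, B y t = 0) → y ∈ T) :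
    Module.finrank F Y ≤ Module.finrank F T := by
  let g : Y →ₗ[F] Module.Dual F T := (B.compl₁₂ Y.subtype T.subtype)
  have hg : ∀ y t, g y t = B y t := fun y t => rfl
  let I : Submodule F T := Y.comap T.subtype
  have h1 := g.finrank_range_add_finrank_ker
  have h2 : LinearMap.range g ≤ I.dualAnnihilator := by
    rintro _ ⟨y, rfl⟩
    rw [Submodule.mem_dualAnnihilator]
    intro t ht
    exact hY _ y.2 _ ht
  have h3 := Submodule.finrank_mono h2
  have h4 := Subspace.finrank_add_finrank_dualAnnihilator_eq I
  have h5 : ∀ y : LinearMap.ker g, ((y : Y) : M) ∈ T := by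
    intro y
    apply hT _ y.1.2
    intro t ht
    have := LinearMap.congr_fun (LinearMap.mem_ker.1 y.2) ⟨t, ht⟩
    exact this
  let k : LinearMap.ker g →ₗ[F] I :=
    LinearMap.codRestrict _ (LinearMap.codRestrict T (Y.subtype ∘ₗ (LinearMap.ker g).subtype) h5)
      (fun y => y.1.2)
  have hk : Function.Injective k := by
    intro y y' h
    have : ((k y : T) : M) = (k y' : T) := by rw [h]
    exact Subtype.ext (Subtype.ext this)
  have h6 := LinearMap.finrank_le_finrank_of_injective hk
  omega

section hyp
variable {K : Type} [Field K]

lemma finrank_subprod {M N : Type} [AddCommGroup M] [Module K M] [AddCommGroup N] [Module K N]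
    [FiniteDimensional K M] [FiniteDimensional K N] (S : Submodule K M) (T : Submodule K N) :
    Module.finrank K (S.prod T) ≤ Module.finrank K S + Module.finrank K T := by
  rw [← Module.finrank_prod]
  let g : (S.prod T) →ₗ[K] S × T := LinearMap.prod
    (LinearMap.codRestrict S (LinearMap.fst K M N ∘ₗ (S.prod T).subtype) (fun x => x.2.1))
    (LinearMap.codRestrict T (LinearMap.snd K M N ∘ₗ (S.prod T).subtype) (fun x => x.2.2))
  apply LinearMap.finrank_le_finrank_of_injective (f := g)
  intro x y h
  have h1 : ((g x).1 : M) = (g y).1 := by rw [h]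
  have h2 : ((g x).2 : N) = (g y).2 := by rw [h]
  exact Subtype.ext (Prod.ext h1 h2)

lemma hyp_succ_q (m : ℕ) (x : Fin 2 → K) (y : (QF.hyperbolics m : QF K).V) :
    (QF.hyperbolics (m+1) : QF K).q ((x, y) : (Fin 2 → K) × (QF.hyperbolics m : QF K).V)
      = x 0 * x 0 - x 1 * x 1 + (QF.hyperbolics m : QF K).q y := by
  change (weightedSumSquares K ![(1 : K), -1]).prod (QF.hyperbolics m : QF K).q (x, y) = _
  simp [weightedSumSquares_apply, Fin.sum_univ_two]
  ring

lemma hyp_finrank (m : ℕ) : Module.finrank K (QF.hyperbolics m : QF K).V = 2 * m := by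
  induction m with
  | zero => exact Module.finrank_fin_fun K
  | succ m ih =>
    change Module.finrank K ((Fin 2 → K) × (QF.hyperbolics m : QF K).V) = _
    rw [Module.finrank_prod, ih, Module.finrank_fin_fun]; ring

lemma hyp_lagr [Invertible (2 : K)] (m : ℕ) : ∃ T : Submodule K (QF.hyperbolics m : QF K).V,
    Module.finrank K T ≤ m ∧ (∀ x ∈ T, (QF.hyperbolics m : QF K).q x = 0) ∧
    ∀ x, (∀ t ∈ T, polar (QF.hyperbolics m : QF K).q x t = 0) → x ∈ T := by
  have h2 : (2 : K) * ⅟2 = 1 := mul_invOf_self _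
  induction m with
  | zero =>
    have : Subsingleton (QF.hyperbolics 0 : QF K).V :=
      inferInstanceAs (Subsingleton (Fin 0 → K))
    refine ⟨⊥, by simp, ?_, ?_⟩
    · intro x hx
      rw [(Submodule.mem_bot K).1 hx]; simp
    · intro x _
      rw [Subsingleton.elim x 0]; simp
  | succ m ih =>
    obtain ⟨T, h1, hq, h3⟩ := ih
    let e : Fin 2 → K := fun _ => 1
    let T' : Submodule K ((Fin 2 → K) × (QF.hyperbolics m : QF K).V) :=
      (Submodule.span K {e}).prod T
    have hP : ∀ a b : (Fin 2 → K) × (QF.hyperbolics m : QF K).V,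
        polar ((weightedSumSquares K ![(1 : K), -1]).prod (QF.hyperbolics m : QF K).q) a b
        = 2 * (a.1 0 * b.1 0 - a.1 1 * b.1 1) + polar (QF.hyperbolics m : QF K).q a.2 b.2 := by
      intro a b
      rw [polar_prod]
      congr 1
      simp [polar, weightedSumSquares_apply, Fin.sum_univ_two]
      ring
    refine ⟨T', ?_, ?_, ?_⟩
    · have := finrank_subprod (Submodule.span K {e}) T
      have h5 := finrank_span_le_card (R := K) ({e} : Set (Fin 2 → K))
      simp only [Set.toFinset_singleton, Finset.card_singleton] at h5
      have h6 : Module.finrank K T' ≤ m + 1 := by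
        change Module.finrank K ((Submodule.span K {e}).prod T) ≤ m + 1
        omega
      exact h6
    · rintro ⟨x, y⟩ ⟨hx, hy⟩
      obtain ⟨c, rfl⟩ := Submodule.mem_span_singleton.1 hx
      refine (hyp_succ_q m _ _).trans ?_
      rw [hq y hy]; simp [e]
    · intro z hz
      obtain ⟨x, y⟩ : (Fin 2 → K) × (QF.hyperbolics m : QF K).V := z
      have hz' : ∀ t ∈ T', polar ((weightedSumSquares K ![(1 : K), -1]).prod
          (QF.hyperbolics m : QF K).q) (x, y) t = 0 := hz
      refine ⟨?_, h3 y ?_⟩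
      · have := hz' (e, 0) ⟨Submodule.mem_span_singleton_self e, T.zero_mem⟩
        rw [hP] at this
        simp only [polar_zero_right, e, mul_one, add_zero] at this
        have h : x 0 = x 1 := by linear_combination ⅟2 * this - (x 0 - x 1) * h2
        refine Submodule.mem_span_singleton.2 ⟨x 0, ?_⟩
        ext i; fin_cases i <;> simp [e, h]
      · intro t ht
        have := hz' (0, t) ⟨Submodule.zero_mem _, ht⟩
        rw [hP] at this
        simpa using this

lemma assoc_equiv (m : ℕ) {M : Type} [AddCommGroup M] [Module K M] (Q : QuadraticForm K M) (φ : QF K)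
    (N : Type) [AddCommGroup N] [Module K N] (Q' : QuadraticForm K N)
    (h : Q.Equivalent ((weightedSumSquares K ![(1 : K), -1]).prod Q'))
    (h' : Q'.Equivalent ((QF.hyperbolics m : QF K).q.prod φ.q)) :
    Q.Equivalent ((QF.hyperbolics (m+1) : QF K).q.prod φ.q) := by
  refine h.trans ((QuadraticMap.Equivalent.prod (QuadraticMap.Equivalent.refl _) h').trans ?_)
  refine ⟨⟨(LinearEquiv.prodAssoc K (Fin 2 → K) (QF.hyperbolics m : QF K).V φ.V).symm, ?_⟩⟩
  rintro ⟨x, y, z⟩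
  exact add_assoc _ _ _
end hyp

section emb
variable {K L : Type} [Field K] [Field L] [Algebra K L] [Invertible (2 : K)] [Invertible (2 : L)]

lemma polar_emb {N M : Type} [AddCommGroup N] [Module K N] [AddCommGroup M] [Module L M]
    [Module K M] (q : QuadraticForm K N) (Q : QuadraticForm L M)
    (j : N →ₗ[K] M) (hj : ∀ x, Q (j x) = algebraMap K L (q x)) (x y : N) :
    polar Q (j x) (j y) = algebraMap K L (polar q x y) := by
  simp only [polar, ← map_add, hj, map_sub]

lemma emb (m : ℕ) : ∀ (M : Type) [AddCommGroup M] [Module L M] [Module K M] [IsScalarTower K L M]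
    [FiniteDimensional L M] (Q : QuadraticForm L M)
    (j : (QF.hyperbolics m : QF K).V →ₗ[K] M)
    (_ : ∀ x, Q (j x) = algebraMap K L ((QF.hyperbolics m : QF K).q x)),
    ∃ ψ : QF L, Q.Equivalent ((QF.hyperbolics m : QF L).q.prod ψ.q) := by
  have h2 : (2 : K) * ⅟2 = 1 := mul_invOf_self _
  induction m with
  | zero =>
    intro M _ _ _ _ _ Q j hj
    refine ⟨⟨M, Q⟩, ?_⟩
    have : Subsingleton (QF.hyperbolics 0 : QF L).V :=
      inferInstanceAs (Subsingleton (Fin 0 → L))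
    have : Unique (QF.hyperbolics 0 : QF L).V := ⟨⟨0⟩, fun x => Subsingleton.elim _ _⟩
    refine ⟨⟨LinearEquiv.symm (LinearEquiv.uniqueProd), ?_⟩⟩
    intro x
    simp
    rfl
  | succ m ih =>
    intro M _ _ _ _ _ Q j hj
    let j' : ((Fin 2 → K) × (QF.hyperbolics m : QF K).V) →ₗ[K] M := j
    have hj' : ∀ x y, Q (j' (x, y)) = algebraMap K L
      (x 0 * x 0 - x 1 * x 1 + (QF.hyperbolics m : QF K).q y) := by
      intro x y
      rw [← hyp_succ_q]; exact hj _
    let v := j' (![⅟2, -⅟2], 0)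
    let u := j' (![⅟2, ⅟2], 0)
    have hv : Q v = 0 := by simp [v, hj']
    have hu : Q u = 0 := by simp [u, hj']
    have hvu : polar Q v u = 1 := by
      have : v + u = j' (![1, 0], 0) := by
        simp only [v, u, ← map_add]
        congr 1
        ext i
        · fin_cases i
          · exact invOf_two_add_invOf_two
          · exact neg_add_cancel _
        · simp
      rw [polar, hv, hu, this, hj']; simp
    have hp : ∀ (x : Fin 2 → K) y, polar Q (j' (x, 0)) (j' (0, y)) = 0 := by
      intro x y
      rw [polar, ← map_add, hj', hj']
      simp [hj']
    have hmem : ∀ y, j' (0, y) ∈ perp Q v u := fun y => mem_perp.2 ⟨hp _ _, hp _ _⟩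
    let j2 : (QF.hyperbolics m : QF K).V →ₗ[K] perp Q v u :=
      { toFun := fun y => ⟨j' (0, y), hmem y⟩
        map_add' := fun y z => Subtype.ext (by
          change j' (0, y + z) = j' (0, y) + j' (0, z)
          rw [← map_add]; simp)
        map_smul' := fun c y => Subtype.ext (by
          change j' (0, c • y) = c • j' (0, y)
          rw [← map_smul]; simp) }
    obtain ⟨ψ, hψ⟩ := ih (perp Q v u) (Q.comp (perp Q v u).subtype) j2 (by
      intro y
      change Q (j' (0, y)) = _
      rw [hj']; simp)
    exact ⟨ψ, assoc_equiv m Q ψ _ _ (split_plane Q v u hv hu hvu) hψ⟩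
end emb


section common
variable {K : Type} [Field K] [Invertible (2 : K)]

lemma common_value (m : ℕ) (ψ : QF K) (a : K) (ha : a ≠ 0)
    (f : ((QF.hyperbolics m : QF K).V × ψ.V) →ₗ[K] ((QF.hyperbolics m : QF K).V × ψ.V))
    (hf : ∀ z, ((QF.hyperbolics m : QF K).q.prod ψ.q) (f z)
      = a * ((QF.hyperbolics m : QF K).q.prod ψ.q) z)
    (hpos : 0 < Module.finrank K ψ.V) :
    ∃ v w : ψ.V, ¬ (v = 0 ∧ w = 0) ∧ ψ.q w = a * ψ.q v := by
  by_contra hcon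
  push Not at hcon
  obtain ⟨T0, hT1, hT2, hT3⟩ := hyp_lagr (K := K) m
  set Q := (QF.hyperbolics m : QF K).q.prod ψ.q with hQ
  let Q2 := Q.prod ((-a) • Q)
  let g := f.prod (LinearMap.id (R := K) (M := (QF.hyperbolics m : QF K).V × ψ.V))
  have hg : Function.Injective g := by
    intro x y h
    exact (Prod.ext_iff.1 h).2
  have hQ2 : ∀ z, Q2 (g z) = 0 := by
    intro z
    change Q (f z) + (-a) * Q z = 0
    rw [hf]; ring
  have hpol : ∀ x y, polar Q2 x y = polar Q x.1 y.1 + (-a) * polar Q x.2 y.2 := by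
    intro x y
    simp only [Q2, polar_prod]
    congr 1
    simp [polar]
    ring
  have hb := ti_bound (polarBilin Q2) ((T0.prod ⊥).prod (T0.prod ⊥)) (LinearMap.range g) (by
      rintro _ ⟨x, rfl⟩ _ ⟨y, rfl⟩
      change Q2 (g x + g y) - Q2 (g x) - Q2 (g y) = 0
      rw [← map_add, hQ2, hQ2, hQ2]; simp) (by
      rintro _ ⟨z, rfl⟩ hz
      have hz' : ∀ t ∈ ((T0.prod ⊥).prod (T0.prod (⊥ : Submodule K ψ.V))),
        polar Q (f z) t.1 + (-a) * polar Q z t.2 = 0 := by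
        intro t ht
        have := hz t ht
        rw [polarBilin_apply_apply, hpol] at this
        exact this
      have h1 : (f z).1 ∈ T0 := by
        apply hT3
        intro t ht
        have := hz' ((t, 0), (0, 0)) ⟨⟨ht, rfl⟩, ⟨T0.zero_mem, rfl⟩⟩
        rw [hQ, polar_prod, polar_prod] at this
        simpa using this
      have h2 : z.1 ∈ T0 := by
        apply hT3
        intro t ht
        have := hz' ((0, 0), (t, 0)) ⟨⟨T0.zero_mem, rfl⟩, ⟨ht, rfl⟩⟩
        rw [hQ, polar_prod, polar_prod] at this
        simpa [ha] using this
      have h3 := hf z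
      rw [hQ, prod_apply, prod_apply, hT2 _ h1, hT2 _ h2, zero_add, zero_add] at h3
      by_cases h0 : z.2 = 0 ∧ (f z).2 = 0
      · exact ⟨⟨h1, h0.2⟩, ⟨h2, h0.1⟩⟩
      · exact absurd h3 (hcon _ _ (fun h h' => h0 ⟨h, h'⟩)))
  rw [LinearMap.finrank_range_of_inj hg, Module.finrank_prod, hyp_finrank] at hb
  have k1 := finrank_subprod (K := K) T0 (⊥ : Submodule K ψ.V)
  have k2 := finrank_subprod (K := K) (T0.prod (⊥ : Submodule K ψ.V)) (T0.prod (⊥ : Submodule K ψ.V))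
  rw [finrank_bot] at k1
  omega
end common

section bc
variable {K L : Type} [Field K] [Field L] [Algebra K L] [Invertible (2 : K)] [Invertible (2 : L)]

lemma polar_bc {V : Type} [AddCommGroup V] [Module K V] (q : QuadraticForm K V) (x y : L) (v w : V) :
    polar (QuadraticForm.baseChange L q) (x ⊗ₜ[K] v) (y ⊗ₜ[K] w)
      = x * y * algebraMap K L (polar q v w) := by
  rw [← polarBilin_apply_apply, QuadraticForm.polarBilin_baseChange]
  simp [Algebra.smul_def]
  ring

lemma pair_bc {V : Type} [AddCommGroup V] [Module K V] (q : QuadraticForm K V) (v w : V)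
    (s : L) (hs0 : s ≠ 0) (hv : q v ≠ 0)
    (hs : s * s = algebraMap K L (polar q v w ^ 2 - 4 * q v * q w)) :
    ∃ ξ u : L ⊗[K] V, QuadraticForm.baseChange L q ξ = 0 ∧ QuadraticForm.baseChange L q u = 0 ∧
      polar (QuadraticForm.baseChange L q) ξ u = 1 ∧
      ∀ y, polar q v y = 0 → polar q w y = 0 → (1 : L) ⊗ₜ[K] y ∈
        perp (QuadraticForm.baseChange L q) ξ u := by
  have h2 : (2 : L) ≠ 0 := Invertible.ne_zero 2
  have hcL : algebraMap K L (q v) ≠ 0 := by simpa using hv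
  simp only [map_sub, map_mul, map_pow, map_ofNat] at hs
  obtain ⟨ξ, hξdef⟩ : ∃ ξ : L ⊗[K] V, ξ = (-algebraMap K L (polar q v w) + s) ⊗ₜ v
    + (2 * algebraMap K L (q v)) ⊗ₜ w := ⟨_, rfl⟩
  have hξ : QuadraticForm.baseChange L q ξ = 0 := by
    simp only [hξdef, q_add, polar_bc, QuadraticForm.baseChange_tmul, Algebra.smul_def]
    linear_combination (algebraMap K L (q v)) * hs
  have hp : polar (QuadraticForm.baseChange L q) ξ ((1 : L) ⊗ₜ v) ≠ 0 := by
    have : polar (QuadraticForm.baseChange L q) ξ ((1 : L) ⊗ₜ v)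
        = 2 * algebraMap K L (q v) * s := by
      rw [hξdef, polar_add_left, polar_bc, polar_bc, polar_self', polar_comm q w v, map_mul,
        map_ofNat]
      ring
    rw [this]
    exact mul_ne_zero (mul_ne_zero h2 hcL) hs0
  obtain ⟨s', t', hu, hξu⟩ := exists_pair _ ξ _ hξ hp
  refine ⟨ξ, _, hξ, hu, hξu, ?_⟩
  intro y h1 h3
  have hy : polar (QuadraticForm.baseChange L q) ξ ((1 : L) ⊗ₜ y) = 0 := by
    rw [hξdef, polar_add_left, polar_bc, polar_bc, h1, h3]
    simp
  refine mem_perp.2 ⟨hy, ?_⟩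
  rw [polar_add_left, polar_smul_left, polar_smul_left, hy, polar_bc, h1]
  simp

lemma emb_perp (m : ℕ) {M : Type} [AddCommGroup M] [Module L M] [Module K M] [IsScalarTower K L M]
    [FiniteDimensional L M] (Q : QuadraticForm L M) (ξ u : M) (hξ : Q ξ = 0) (hu : Q u = 0)
    (hξu : polar Q ξ u = 1) (h : (QF.hyperbolics m : QF K).V →ₗ[K] M)
    (hp : ∀ y, h y ∈ perp Q ξ u)
    (hh : ∀ y, Q (h y) = algebraMap K L ((QF.hyperbolics m : QF K).q y)) :
    ∃ ψ' : QF L, Q.Equivalent ((QF.hyperbolics (m+1) : QF L).q.prod ψ'.q) := by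
  let j : (QF.hyperbolics m : QF K).V →ₗ[K] perp Q ξ u :=
      { toFun := fun y => ⟨h y, hp y⟩
        map_add' := fun y z => Subtype.ext (map_add h y z)
        map_smul' := fun c y => Subtype.ext (map_smul h c y) }
  obtain ⟨ψ', hψ'⟩ := emb m (perp Q ξ u) (Q.comp (perp Q ξ u).subtype) j hh
  exact ⟨ψ', assoc_equiv m Q ψ' _ _ (split_plane Q ξ u hξ hu hξu) hψ'⟩

lemma bc_equiv (m : ℕ) (V : Type) [AddCommGroup V] [Module K V] [FiniteDimensional K V]
    (q : QuadraticForm K V)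
    (ψ : QF K) (e : q.IsometryEquiv ((QF.hyperbolics m : QF K).q.prod ψ.q)) (v w : ψ.V)
    (s : L) (hs0 : s ≠ 0) (hv : ψ.q v ≠ 0)
    (hs : s * s = algebraMap K L (polar ψ.q v w ^ 2 - 4 * ψ.q v * ψ.q w)) :
    ∃ ψ' : QF L, (QuadraticForm.baseChange L q).Equivalent
      ((QF.hyperbolics (m+1) : QF L).q.prod ψ'.q) := by
  let i : ψ.V → V := fun x => e.symm (0, x)
  have hi : ∀ x, q (i x) = ψ.q x := by
    intro x
    simp [i]
  have hip : ∀ x y, polar q (i x) (i y) = polar ψ.q x y := by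
    intro x y
    have : i x + i y = i (x + y) := by
      simp only [i, ← map_add]; simp
    simp only [polar, this, hi]
  let h : (QF.hyperbolics m : QF K).V →ₗ[K] V :=
    e.symm.toLinearEquiv.toLinearMap ∘ₗ LinearMap.inl K _ _
  have hdef : ∀ x, h x = e.symm (x, 0) := fun _ => rfl
  have hh : ∀ x, q (h x) = (QF.hyperbolics m : QF K).q x := by
    intro x
    simp [hdef]
  have hih : ∀ x y, polar q (i x) (h y) = 0 := by
    intro x y
    have : i x + h y = e.symm (y, x) := by
      simp only [i, hdef, ← map_add]; simp
    simp only [polar, this, hi, hh]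
    simp
  obtain ⟨ξ, u, hξ, hu, hξu, hperp⟩ := pair_bc q (i v) (i w) s hs0 (by rwa [hi])
    (by rw [hip, hi, hi]; exact hs)
  exact emb_perp m _ ξ u hξ hu hξu (TensorProduct.mk K L V 1 ∘ₗ h)
    (fun y => hperp _ (hih _ _) (hih _ _)) (fun y => by
      change QuadraticForm.baseChange L q ((1 : L) ⊗ₜ h y) = _
      rw [QuadraticForm.baseChange_tmul, hh, Algebra.smul_def]; simp)
end bc

section witt
variable {K : Type} [Field K]

lemma witt_bdd (φ : QF K) : BddAbove {m : ℕ | ∃ ψ : QF K, φ.Equiv (QF.add (QF.hyperbolics m) ψ)} := by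
  refine ⟨Module.finrank K φ.V, ?_⟩
  rintro m ⟨ψ, ⟨e⟩⟩
  have e' : φ.V ≃ₗ[K] ((QF.hyperbolics m : QF K).V × ψ.V) := e.toLinearEquiv
  have := e'.finrank_eq
  rw [Module.finrank_prod, hyp_finrank] at this
  omega

lemma le_witt (φ : QF K) (m : ℕ) (ψ : QF K) (h : φ.Equiv (QF.add (QF.hyperbolics m) ψ)) :
    m ≤ φ.wittIndex := le_csSup (witt_bdd φ) ⟨ψ, h⟩

lemma witt_mem [Invertible (2 : K)] (φ : QF K) :
    ∃ ψ : QF K, φ.Equiv (QF.add (QF.hyperbolics φ.wittIndex) ψ) := by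
  refine Nat.sSup_mem (s := {m : ℕ | ∃ ψ : QF K, φ.Equiv (QF.add (QF.hyperbolics m) ψ)}) ?_
    (witt_bdd φ)
  refine ⟨0, ?_⟩
  have : Subsingleton (QF.hyperbolics 0 : QF K).V :=
      inferInstanceAs (Subsingleton (Fin 0 → K))
  exact emb (K := K) (L := K) 0 φ.V φ.q 0 (by
    intro x; rw [Subsingleton.elim x 0]; simp)

lemma left_comm_equiv {A B C : Type} [AddCommGroup A] [AddCommGroup B] [AddCommGroup C]
    [Module K A] [Module K B] [Module K C] (q₁ : QuadraticForm K A) (q₂ : QuadraticForm K B)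
    (q₃ : QuadraticForm K C) :
    (q₁.prod (q₂.prod q₃)).Equivalent (q₂.prod (q₁.prod q₃)) := by
  let e : (A × B × C) ≃ₗ[K] (B × A × C) :=
    { toFun := fun x => (x.2.1, x.1, x.2.2)
      invFun := fun x => (x.2.1, x.1, x.2.2)
      map_add' := fun _ _ => rfl
      map_smul' := fun _ _ => rfl
      left_inv := fun _ => rfl
      right_inv := fun _ => rfl }
  exact ⟨⟨e, fun x => add_left_comm _ _ _⟩⟩

lemma aniso_of_witt [Invertible (2 : K)] (φ : QF K) (hφ : φ.Nondeg) (ψ : QF K)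
    (h : φ.Equiv (QF.add (QF.hyperbolics φ.wittIndex) ψ)) : ψ.Anisotropic := by
  by_contra hani
  obtain ⟨x, hx, hx0⟩ : ∃ x, ψ.q x = 0 ∧ x ≠ 0 := by
    simpa [QF.Anisotropic, QuadraticMap.Anisotropic] using hani
  obtain ⟨e⟩ := h
  have e : φ.q.IsometryEquiv ((QF.hyperbolics φ.wittIndex : QF K).q.prod ψ.q) := e
  have hex : e.symm (0, x) ≠ 0 := by
    intro h
    apply hx0
    have := e.symm.toLinearEquiv.map_eq_zero_iff.1 h
    exact (Prod.ext_iff.1 this).2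
  obtain ⟨y, hy⟩ : ∃ y, polar φ.q (e.symm (0, x)) y ≠ 0 := by
    by_contra hc
    push Not at hc
    exact hex (hφ.1 _ hc)
  have hxy : polar ψ.q x (e y).2 ≠ 0 := by
    intro h0
    apply hy
    have : polar φ.q (e.symm (0, x)) y
      = polar ((QF.hyperbolics φ.wittIndex : QF K).q.prod ψ.q) (0, x) (e y) := by
      have h1 : e (e.symm (0, x) + y) = (0, x) + e y := by
        rw [map_add]; simp
      simp only [polar]
      rw [← h1, e.map_app, e.map_app, e.symm.map_app]
    rw [this, polar_prod]
    simp [h0]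
  obtain ⟨s, t, hu, hxu⟩ := exists_pair ψ.q x _ hx hxy
  set u := s • x + t • (e y).2
  have hsp := split_plane ψ.q x u hx hu hxu
  have : φ.q.Equivalent ((weightedSumSquares K ![(1 : K), -1]).prod
      ((QF.hyperbolics φ.wittIndex : QF K).q.prod (ψ.q.comp (perp ψ.q x u).subtype))) := by
    refine QuadraticMap.Equivalent.trans ⟨e⟩ ?_
    refine (QuadraticMap.Equivalent.prod (QuadraticMap.Equivalent.refl _) hsp).trans ?_
    exact left_comm_equiv _ _ _
  have := assoc_equiv φ.wittIndex φ.q ⟨perp ψ.q x u, ψ.q.comp (perp ψ.q x u).subtype⟩ _ _ this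
    (QuadraticMap.Equivalent.refl _)
  have := le_witt φ _ _ this
  omega

lemma exists_ext [Invertible (2 : K)] (d : K) (hd : ∀ r, r * r ≠ d) :
    ∃ L : FieldExt K, Module.finrank K L.carrier = 2 ∧ ∃ s : L.carrier, s ≠ 0 ∧
      s * s = algebraMap K L.carrier d ∧
      ∀ a x y : K, a = x * x - d * (y * y) → a ≠ 0 → a ∈ normSet K L.carrier := by
  haveI : Fact (∀ r : K, r ^ 2 ≠ d + 0 * r) := ⟨fun r h => hd r (by rw [← pow_two, h]; ring)⟩
  refine ⟨⟨QuadraticAlgebra K d 0⟩, QuadraticAlgebra.finrank_eq_two _ _, QuadraticAlgebra.omega,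
    ?_, ?_, ?_⟩
  · intro h
    have := congrArg QuadraticAlgebra.im h
    simp at this
  · rw [QuadraticAlgebra.omega_mul_omega_eq_algebraMap]
    simp
  · intro a x y h ha
    have hn : Algebra.norm K (⟨x, y⟩ : QuadraticAlgebra K d 0) = a := by
      have := QuadraticAlgebra.det_toLinearMap_eq_norm (⟨x, y⟩ : QuadraticAlgebra K d 0)
      rw [h]
      refine this.trans ?_
      simp [QuadraticAlgebra.norm]
      ring
    refine ⟨(⟨x, y⟩ : QuadraticAlgebra K d 0), ?_, hn⟩
    intro h0
    apply ha
    rw [← hn]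
    change Algebra.norm K (⟨x, y⟩ : QuadraticAlgebra K d 0) = 0
    have : (⟨x, y⟩ : QuadraticAlgebra K d 0) = 0 := h0
    rw [this]
    haveI : Nontrivial (QuadraticAlgebra K d 0) := inferInstance
    haveI : Module.Finite K (QuadraticAlgebra K d 0) := inferInstance
    exact Algebra.norm_zero

/-- conclusion from two suitable vectors of the anisotropic part -/
lemma conclude [Invertible (2 : K)] (φ ψ : QF K)
    (h : φ.Equiv (QF.add (QF.hyperbolics φ.wittIndex) ψ)) (hani : ψ.Anisotropic)
    (v w : ψ.V) (hv : v ≠ 0) (hw : ∀ r : K, w ≠ r • v) (a : K) (ha : a ≠ 0)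
    (hor : ψ.q w = a * ψ.q v ∨ ∃ r : K, a = r * r) :
    ∃ L : FieldExt K, Module.finrank K L.carrier = 2 ∧
        QF.wittIndex (QF.baseChange L.carrier φ) > QF.wittIndex φ ∧
        a ∈ normSet K L.carrier := by
  have h2 : (2 : K) ≠ 0 := Invertible.ne_zero 2
  have hc : ψ.q v ≠ 0 := fun h => hv (hani _ h)
  obtain ⟨L, hL, s, hs0, hs, hnorm⟩ := exists_ext
    (polar ψ.q v w ^ 2 - 4 * ψ.q v * ψ.q w) (by
    intro r hr
    have h1 : ψ.q ((-polar ψ.q v w + r) • v + (2 * ψ.q v) • w) = 0 := by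
      simp only [q_add, polar_smul_left, polar_smul_right, QuadraticMap.map_smul, smul_eq_mul]
      linear_combination ψ.q v * hr
    have h3 := hani _ h1
    apply hw ((2 * ψ.q v)⁻¹ * (polar ψ.q v w - r))
    have h4 : (2 * ψ.q v) ≠ 0 := mul_ne_zero h2 hc
    rw [mul_smul, eq_inv_smul_iff₀ h4]
    rw [← sub_eq_zero, ← h3]
    module)
  letI : Invertible (2 : L.carrier) :=
    invertibleOfNonzero (by
      intro h
      apply h2
      apply (algebraMap K L.carrier).injective
      rw [map_ofNat, map_zero]; exact h)
  refine ⟨L, hL, ?_, ?_⟩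
  · obtain ⟨e⟩ := h
    obtain ⟨ψ', hψ'⟩ := bc_equiv φ.wittIndex φ.V φ.q ψ e v w s hs0 hc hs
    exact le_witt (QF.baseChange L.carrier φ) _ ψ' hψ'
  · rcases hor with h1 | ⟨r, hr⟩
    · refine hnorm a (polar ψ.q v w * (2 * ψ.q v)⁻¹) (2 * ψ.q v)⁻¹ ?_ ha
      rw [h1]
      field_simp
      ring
    · exact hnorm a r 0 (by rw [hr]; ring) ha
end witt

theorem main (K : Type) [Field K] [Invertible (2 : K)]
    (φ : QF K) (hφ : φ.Nondeg) (a : K) (ha : a ∈ QF.G φ) :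
    φ.IsSplit ∨
      ∃ L : FieldExt K, Module.finrank K L.carrier = 2 ∧
        QF.wittIndex (QF.baseChange L.carrier φ) > QF.wittIndex φ ∧
        a ∈ normSet K L.carrier := by
  obtain ⟨ψ, hψ⟩ := witt_mem φ
  have hani := aniso_of_witt φ hφ ψ hψ
  by_cases hdim : ψ.dim ≤ 1
  · exact Or.inl ⟨_, ψ, hani, hdim, hψ⟩
  right
  have hdim' : 1 < Module.finrank K ψ.V := by
    simpa [QF.dim] using hdim
  have hψ0 := hψ
  obtain ⟨ha0, ⟨F⟩⟩ := ha
  obtain ⟨e⟩ := hψ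
  have e : φ.q.IsometryEquiv ((QF.hyperbolics φ.wittIndex : QF K).q.prod ψ.q) := e
  have F : (a • φ.q).IsometryEquiv φ.q := F
  obtain ⟨v, w, hvw, hval⟩ := common_value φ.wittIndex ψ a ha0
    (e.toLinearEquiv.toLinearMap ∘ₗ F.toLinearEquiv.toLinearMap ∘ₗ
      e.symm.toLinearEquiv.toLinearMap) (by
    intro z
    change ((QF.hyperbolics φ.wittIndex : QF K).q.prod ψ.q) (e (F (e.symm z))) = _
    rw [e.map_app, F.map_app, _root_.smul_apply, e.symm.map_app, smul_eq_mul]) (by omega)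
  have hv : v ≠ 0 := by
    rintro rfl
    apply hvw
    refine ⟨rfl, hani _ ?_⟩
    rw [hval]; simp
  have hc : ψ.q v ≠ 0 := fun h => hv (hani _ h)
  by_cases hw : ∀ r : K, w ≠ r • v
  · exact conclude φ ψ hψ0 hani v w hv hw a ha0 (Or.inl hval)
  · push Not at hw
    obtain ⟨r, rfl⟩ := hw
    rw [QuadraticMap.map_smul, smul_eq_mul] at hval
    have hr := mul_right_cancel₀ hc hval
    obtain ⟨w', hw'⟩ : ∃ w' : ψ.V, ∀ r : K, w' ≠ r • v := by
      by_contra hcon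
      push Not at hcon
      have := finrank_le_one v (fun w => (hcon w).imp fun _ h => h.symm)
      omega
    exact conclude φ ψ hψ0 hani v w' hv hw' a ha0 (Or.inr ⟨r, hr.symm⟩)
end QFaux

/-- either `φ` is split, or some quadratic extension increases the
Witt index and contains `a` in its norm group. -/
theorem stmt1 (K : Type) [Field K] [Invertible (2 : K)]
    (φ : QF K) (hφ : φ.Nondeg) (a : K) (ha : a ∈ QF.G φ) :
    φ.IsSplit ∨
      ∃ L : FieldExt K, Module.finrank K L.carrier = 2 ∧
        QF.wittIndex (QF.baseChange L.carrier φ) > QF.wittIndex φ ∧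
        a ∈ normSet K L.carrier := by
  exact QFaux.main K φ hφ a ha
end
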